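/- Let F be an algebraically closed field of characteristic different from 2, 3 and 5, and let (U, ω) be a finite-dimensional b-alternative algebra over F. Then U has a Wedderburn b-decomposition: there exist a b-semisimple b-subalgebra S of U and a vector subspace V of bar(U) with V·V ⊆ rad(U) such that U = S ⊕ V ⊕ rad(U) as a direct sum of vector spaces. -/

import Mathlib

/-! Wedderburn b-decomposition for finite-dimensional b-alternative algebras
over an algebraically closed field of characteristic ≠ 2, 3, 5. -/

section BaricDefs

variable (F : Type*) [Field F] (U : Type*) [NonUnitalNonAssocRing U]
  [Module F U] [SMulCommClass F U U] [IsScalarTower F U U]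
  (ω : U →ₗ[F] F)

/-- The bar set of a subalgebra `B`: elements of `B` of weight zero. -/
def barSet (B : NonUnitalSubalgebra F U) : Set U := {x | x ∈ B ∧ ω x = 0}

/-- `B` is a b-subalgebra: a subalgebra not contained in the kernel of the weight. -/
def IsBSubalgebra (B : NonUnitalSubalgebra F U) : Prop := ∃ x ∈ B, ω x ≠ 0

/-- `B` is a normal b-subalgebra: a b-subalgebra whose bar set is a two-sided
ideal of the whole algebra `U`. -/
def IsNormalBSubalgebra (B : NonUnitalSubalgebra F U) : Prop :=
  IsBSubalgebra F U ω B ∧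
    ∀ x ∈ barSet F U ω B, ∀ u : U, u * x ∈ barSet F U ω B ∧ x * u ∈ barSet F U ω B

/-- `B` is a maximal normal b-subalgebra: normal, and no normal b-subalgebra lies
strictly between `B` and `U`. -/
def IsMaximalNormalBSubalgebra (B : NonUnitalSubalgebra F U) : Prop :=
  IsNormalBSubalgebra F U ω B ∧
    ¬ ∃ C : NonUnitalSubalgebra F U, IsNormalBSubalgebra F U ω C ∧ B < C ∧ C < ⊤

/-- `(U, ω)` is b-simple: every normal b-subalgebra has bar set `(0)` or `bar(U)`. -/
def IsBSimple : Prop :=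
  ∀ B : NonUnitalSubalgebra F U, IsNormalBSubalgebra F U ω B →
    barSet F U ω B = {0} ∨ barSet F U ω B = {x : U | ω x = 0}

open Classical in
/-- The b-radical of `(U, ω)`: `(0)` if `(U, ω)` is b-simple, and otherwise the
intersection of the bar sets of the maximal normal b-subalgebras. -/
noncomputable def bRad : Set U :=
  if IsBSimple F U ω then {0}
  else ⋂ B ∈ {B : NonUnitalSubalgebra F U | IsMaximalNormalBSubalgebra F U ω B},
    barSet F U ω B

/-- The inclusion of a subalgebra as a linear map. -/
def subalgebraIncl (S : NonUnitalSubalgebra F U) : ↥S →ₗ[F] U where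
  toFun := Subtype.val
  map_add' _ _ := rfl
  map_smul' _ _ := rfl

/-- A b-subalgebra `S` is b-semisimple when `(S, ω|_S)` is a b-algebra with zero
b-radical. -/
noncomputable def IsBSemisimpleSubalgebra (S : NonUnitalSubalgebra F U) : Prop :=
  IsBSubalgebra F U ω S ∧ bRad F ↥S (ω.comp (subalgebraIncl F U S)) = {0}

end BaricDefs

section WeaklyClosed

variable {F E : Type*} [Field F] [Ring E] [Algebra F E]

theorem Submodule.isNilpotent_sup_span_singleton {P : Submodule F E} (hP : IsNilpotent P)
    {w : E} (hw : IsNilpotent w) (hPw : ∀ a ∈ P, a * w + w * a ∈ P) :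
    IsNilpotent (P ⊔ Submodule.span F {w}) := by
  obtain ⟨n, hn⟩ := hP
  obtain ⟨k, hk⟩ := hw
  set Q := Submodule.span F {w} with hQ
  have hQk : Q ^ k = 0 := by
    rw [hQ, Submodule.span_pow, Set.singleton_pow, hk]; simp
  have hQP : Q * P ≤ P * Q + P := by
    rw [Submodule.mul_le]
    intro q hq a ha
    obtain ⟨c, rfl⟩ := Submodule.mem_span_singleton.1 hq
    have h1 : a * (c • w) ∈ P * Q := Submodule.mul_mem_mul ha hq
    have h2 := P.smul_mem c (hPw a ha)
    have h3 : c • w * a = -(a * (c • w)) + c • (a * w + w * a) := by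
      simp
    rw [h3, Submodule.add_eq_sup]
    exact Submodule.add_mem_sup (neg_mem h1) h2
  set Y : Submodule F E := 1 + (P + Q) with hY
  have hYP : Y * P ≤ P * Y := by
    calc Y * P = P + (P * P + Q * P) := by rw [hY]; noncomm_ring
      _ ≤ P + (P * P + (P * Q + P)) := by gcongr
      _ = P * Y + P := by rw [hY]; simp only [mul_add, mul_one]; abel
      _ ≤ P * Y := by
        rw [Submodule.add_eq_sup]
        refine sup_le le_rfl ?_
        calc P = P * 1 := by simp
          _ ≤ P * Y := by
            gcongr
            rw [hY, Submodule.add_eq_sup]; exact le_sup_left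
  have hYmP : ∀ m, Y ^ m * P ≤ P * Y ^ m := by
    intro m
    induction m with
    | zero => simp
    | succ m ih =>
      calc Y ^ (m + 1) * P = Y ^ m * (Y * P) := by rw [pow_succ, mul_assoc]
        _ ≤ Y ^ m * (P * Y) := by gcongr
        _ = (Y ^ m * P) * Y := by rw [mul_assoc]
        _ ≤ (P * Y ^ m) * Y := by gcongr
        _ = P * Y ^ (m + 1) := by rw [pow_succ, mul_assoc]
  have h1Y : (1 : Submodule F E) ≤ Y := by
    rw [hY, Submodule.add_eq_sup]; exact le_sup_left
  have hPQY : P + Q ≤ Y := by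
    rw [hY, Submodule.add_eq_sup]; exact le_sup_right
  have hpow : ∀ m, (P + Q) ^ m ≤ Q ^ m + P * Y ^ m := by
    intro m
    induction m with
    | zero =>
      rw [pow_zero, pow_zero, Submodule.add_eq_sup]; exact le_sup_left
    | succ m ih =>
      have hQY : Q ^ m ≤ Y ^ m := by
        have : Q ≤ Y := le_trans (by rw [Submodule.add_eq_sup]; exact le_sup_right) hPQY
        gcongr
      calc (P + Q) ^ (m + 1) = (P + Q) * (P + Q) ^ m := by rw [pow_succ']
        _ ≤ (P + Q) * (Q ^ m + P * Y ^ m) := by gcongr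
        _ = Q ^ (m + 1) + (P * Q ^ m + ((P + Q) * P) * Y ^ m) := by
          rw [pow_succ']; noncomm_ring
        _ ≤ Q ^ (m + 1) + (P * (1 * Y ^ m) + (Y * P) * Y ^ m) := by
          rw [one_mul]; gcongr
        _ ≤ Q ^ (m + 1) + (P * (Y * Y ^ m) + (P * Y) * Y ^ m) := by gcongr
        _ = Q ^ (m + 1) + P * Y ^ (m + 1) := by
          rw [mul_assoc, ← pow_succ', Submodule.add_eq_sup (P * _) (P * _), sup_idem]
  have hk' : (P + Q) ^ k ≤ P * Y ^ k := by
    have := hpow k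
    rwa [hQk, zero_add] at this
  refine ⟨k * n, ?_⟩
  have hfin : ∀ m, (P * Y ^ k) ^ m ≤ P ^ m * Y ^ (k * m) := by
    intro m
    induction m with
    | zero => simp
    | succ m ih =>
      have hcomm : ∀ j, Y ^ k * P ^ j ≤ P ^ j * Y ^ k := by
        intro j
        induction j with
        | zero => simp
        | succ j ihj =>
          calc Y ^ k * P ^ (j + 1) = (Y ^ k * P ^ j) * P := by rw [pow_succ, mul_assoc]
            _ ≤ (P ^ j * Y ^ k) * P := by gcongr
            _ = P ^ j * (Y ^ k * P) := by rw [mul_assoc]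
            _ ≤ P ^ j * (P * Y ^ k) := mul_le_mul_right (hYmP k) _
            _ = P ^ (j + 1) * Y ^ k := by rw [pow_succ, mul_assoc]
      calc (P * Y ^ k) ^ (m + 1) = (P * Y ^ k) * (P * Y ^ k) ^ m := by rw [pow_succ']
        _ ≤ (P * Y ^ k) * (P ^ m * Y ^ (k * m)) := by gcongr
        _ = P * (Y ^ k * P ^ m) * Y ^ (k * m) := by simp only [mul_assoc]
        _ ≤ P * (P ^ m * Y ^ k) * Y ^ (k * m) :=
          mul_le_mul_left (mul_le_mul_right (hcomm m) _) _
        _ = P ^ (m + 1) * Y ^ (k * (m + 1)) := by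
          rw [pow_succ', mul_add, mul_one, add_comm (k * m) k, pow_add]; simp only [mul_assoc]
  have : (P + Q) ^ (k * n) ≤ 0 := by
    calc (P + Q) ^ (k * n) = ((P + Q) ^ k) ^ n := by rw [pow_mul]
      _ ≤ (P * Y ^ k) ^ n := by gcongr
      _ ≤ P ^ n * Y ^ (k * n) := hfin n
      _ = 0 := by rw [hn, zero_mul]
  simpa [Submodule.add_eq_sup] using this

/-- Jacobson's theorem on sets of nilpotent elements closed under the Jordan product. -/
theorem Submodule.isNilpotent_span_of_jordan_closed [FiniteDimensional F E] {T : Set E}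
    (hnil : ∀ a ∈ T, IsNilpotent a) (hT : ∀ a ∈ T, ∀ b ∈ T, a * b + b * a ∈ T) :
    IsNilpotent (Submodule.span F T) := by
  let good : Set (Submodule F E) :=
    {B | IsNilpotent B ∧ ∃ T' ⊆ T, B = Submodule.span F T'}
  have hne : good.Nonempty := ⟨⊥, ⟨1, by simp⟩, ∅, by simp, by simp⟩
  obtain ⟨B, ⟨hBnil, T', hT'T, hBT'⟩, hBmax⟩ :=
    (wellFounded_gt : WellFounded (α := Submodule F E) (· > ·)).has_min good hne
  have key : ∀ t ∈ T, IsNilpotent (B ⊔ Submodule.span F {t}) → t ∈ B := by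
    intro t ht hnilt
    by_contra htB
    refine hBmax (B ⊔ Submodule.span F {t}) ⟨hnilt, T' ∪ {t}, ?_, ?_⟩ ?_
    · exact Set.union_subset hT'T (by simpa using ht)
    · rw [Submodule.span_union, hBT']
    · refine lt_of_le_of_ne le_sup_left fun h => htB ?_
      rw [h]
      exact Submodule.mem_sup_right (Submodule.mem_span_singleton_self t)
  suffices h : T ⊆ B by
    obtain ⟨n, hn⟩ := hBnil
    refine ⟨n, ?_⟩
    have h2 : Submodule.span F T ^ n ≤ B ^ n := by
      have := Submodule.span_le.2 h
      gcongr
    rw [hn] at h2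
    simpa using h2
  -- iterated Jordan products of elements of `T` by elements of `T'`
  let W : ℕ → Set E := fun m =>
    Nat.rec T (fun _ X => {x | ∃ a ∈ T', ∃ y ∈ X, x = a * y + y * a}) m
  have hWT : ∀ m, W m ⊆ T := by
    intro m
    induction m with
    | zero => exact subset_rfl
    | succ m ih =>
      rintro x ⟨a, ha, y, hy, rfl⟩
      exact hT a (hT'T ha) y (ih hy)
  have hWmem : ∀ m, ∀ x ∈ W m,
      x ∈ ∑ i ∈ Finset.range (m + 1), B ^ i * ⊤ * B ^ (m - i) := by
    intro m x hx
    induction m generalizing x with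
    | zero => simp
    | succ m ih =>
      obtain ⟨a, ha, y, hy, rfl⟩ := hx
      have haB : a ∈ B := hBT' ▸ Submodule.subset_span ha
      have hyS := ih y hy
      have h1 : a * y ∈ B * ∑ i ∈ Finset.range (m + 1), B ^ i * ⊤ * B ^ (m - i) :=
        Submodule.mul_mem_mul haB hyS
      have h2 : y * a ∈ (∑ i ∈ Finset.range (m + 1), B ^ i * ⊤ * B ^ (m - i)) * B :=
        Submodule.mul_mem_mul hyS haB
      have e1 : B * ∑ i ∈ Finset.range (m + 1), B ^ i * ⊤ * B ^ (m - i) ≤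
          ∑ i ∈ Finset.range (m + 2), B ^ i * ⊤ * B ^ (m + 1 - i) := by
        rw [Finset.sum_range_succ' _ (m + 1), Finset.mul_sum, Submodule.add_eq_sup]
        refine le_trans (le_of_eq (Finset.sum_congr rfl fun i _ => ?_)) le_sup_left
        rw [pow_succ', Nat.add_sub_add_right]; simp only [mul_assoc]
      have e2 : (∑ i ∈ Finset.range (m + 1), B ^ i * ⊤ * B ^ (m - i)) * B ≤
          ∑ i ∈ Finset.range (m + 2), B ^ i * ⊤ * B ^ (m + 1 - i) := by
        rw [Finset.sum_range_succ _ (m + 1), Finset.sum_mul, Submodule.add_eq_sup]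
        refine le_trans (le_of_eq (Finset.sum_congr rfl fun i hi => ?_)) le_sup_left
        rw [Nat.succ_sub (Nat.lt_succ_iff.1 (Finset.mem_range.1 hi)), pow_succ]
        simp only [mul_assoc]
      exact add_mem (e1 h1) (e2 h2)
  obtain ⟨n, hn⟩ := id hBnil
  have hW0 : W (2 * n) ⊆ B := by
    intro x hx
    have h := hWmem _ x hx
    have : ∑ i ∈ Finset.range (2 * n + 1), B ^ i * ⊤ * B ^ (2 * n - i) = 0 := by
      refine Finset.sum_eq_zero fun i _ => ?_
      rcases le_total n i with hi | hi
      · rw [pow_eq_zero_of_le hi hn, zero_mul, zero_mul]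
      · rw [pow_eq_zero_of_le (show n ≤ 2 * n - i by omega) hn, mul_zero]
    rw [this] at h
    have hx0 : x = 0 := by simpa using h
    rw [hx0]; exact B.zero_mem
  have hdown : ∀ m, W m ⊆ B → W 0 ⊆ B := by
    intro m
    induction m with
    | zero => exact id
    | succ m ih =>
      refine fun hm => ih fun w hw => key w (hWT m hw)
        (Submodule.isNilpotent_sup_span_singleton hBnil (hnil w (hWT m hw)) fun a ha => ?_)
      rw [hBT'] at ha
      induction ha using Submodule.span_induction with
      | mem a ha => exact hm ⟨a, ha, w, hw, rfl⟩
      | zero => simp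
      | add a b _ _ iha ihb =>
        have := add_mem iha ihb
        rwa [show a * w + w * a + (b * w + w * b) = (a + b) * w + w * (a + b) by
          noncomm_ring] at this
      | smul c a _ iha =>
        have := B.smul_mem c iha
        rwa [smul_add, ← smul_mul_assoc, ← mul_smul_comm] at this
  exact hdown _ hW0

end WeaklyClosed

section Alternative

/-- The left and right alternative laws. -/
def IsAlternative (A : Type*) [NonUnitalNonAssocRing A] : Prop :=
  ∀ x y : A, (x * x) * y = x * (x * y) ∧ (y * x) * x = y * (x * x)

namespace IsAlternative

section Identities

variable {A : Type*} [NonUnitalNonAssocRing A]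

theorem left_linearized (h : IsAlternative A) (x y z : A) :
    x * y * z + y * x * z = x * (y * z) + y * (x * z) := by
  have h0 := (h (x + y) z).1
  simp only [mul_add, add_mul] at h0
  have h1 := (h x z).1
  have h2 := (h y z).1
  grind

theorem right_linearized (h : IsAlternative A) (x y z : A) :
    x * y * z + x * z * y = x * (y * z) + x * (z * y) := by
  have h0 := (h (y + z) x).2
  simp only [mul_add, add_mul] at h0
  have h1 := (h y x).2
  have h2 := (h z x).2
  grind

theorem flexible (h : IsAlternative A) (x y : A) : x * y * x = x * (y * x) := by
  have h0 := h.right_linearized x y x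
  have h1 := (h x y).1
  grind

/-- The associator is invariant under cyclic permutations. -/
theorem cyclic (h : IsAlternative A) (x y z : A) :
    x * y * z - x * (y * z) = y * z * x - y * (z * x) := by
  have h0 := h.left_linearized x y z
  have h1 := h.right_linearized y x z
  grind

end Identities

section Powers

variable {F A M : Type*} [Field F] [NonUnitalNonAssocRing A] [Module F A] [SMulCommClass F A A]
  [IsScalarTower F A A] [AddCommGroup M] [Module F M]

theorem commute_mulLeft_mulRight (h : IsAlternative A) (x : A) :
    Commute (LinearMap.mulLeft F x : Module.End F A) (LinearMap.mulRight F x) := by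
  ext y
  simp [← h.flexible x y]

theorem mul_pow_comm (h : IsAlternative A) (x : A) (m : ℕ) :
    ((LinearMap.mulLeft F x : Module.End F A) ^ m) x * x =
      x * ((LinearMap.mulLeft F x : Module.End F A) ^ m) x := by
  have h1 := ((commute_mulLeft_mulRight (F := F) h x).pow_left m).eq
  have h2 := congrArg (fun f : Module.End F A => f x) h1
  simp only [Module.End.mul_apply, LinearMap.mulRight_apply] at h2
  rw [← h2, ← LinearMap.mulLeft_apply (R := F) x x, ← Module.End.mul_apply, ← pow_succ, pow_succ',
    Module.End.mul_apply, LinearMap.mulLeft_apply]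

/-- A linear map into endomorphisms preserving squares preserves all powers. -/
theorem map_pow_of_map_sq (h : IsAlternative A) (h2 : (2 : F) ≠ 0) (J : A →ₗ[F] Module.End F M)
    (hJ : ∀ y, J (y * y) = J y * J y) (x : A) (m : ℕ) :
    J (((LinearMap.mulLeft F x : Module.End F A) ^ m) x) = J x ^ (m + 1) := by
  induction m with
  | zero => simp
  | succ m ih =>
    set z := ((LinearMap.mulLeft F x : Module.End F A) ^ m) x with hz
    have hxz : ((LinearMap.mulLeft F x : Module.End F A) ^ (m + 1)) x = x * z := by
      rw [pow_succ', Module.End.mul_apply, LinearMap.mulLeft_apply]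
    have hcomm : z * x = x * z := mul_pow_comm h x m
    have e1 := hJ (x + z)
    simp only [mul_add, add_mul, map_add, hJ, hcomm, ih] at e1
    have e2 : (2 : F) • J (x * z) = (2 : F) • J x ^ (m + 1 + 1) := by
      have e3 : J x ^ (m + 1) * J x = J x ^ (m + 1 + 1) := by rw [pow_succ _ (m + 1)]
      have e4 : J x * J x ^ (m + 1) = J x ^ (m + 1 + 1) := by rw [pow_succ' _ (m + 1)]
      rw [e3, e4] at e1
      rw [two_smul, two_smul]
      grind
    rw [hxz]
    exact smul_right_injective _ h2 e2

theorem mulLeft_map_pow (h : IsAlternative A) (h2 : (2 : F) ≠ 0) (x : A) (m : ℕ) :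
    (LinearMap.mulLeft F (((LinearMap.mulLeft F x : Module.End F A) ^ m) x) : Module.End F A) =
      LinearMap.mulLeft F x ^ (m + 1) :=
  map_pow_of_map_sq h h2 (LinearMap.mul F A) (fun y => by ext z; simp [(h y z).1]) x m

theorem mulRight_map_pow (h : IsAlternative A) (h2 : (2 : F) ≠ 0) (x : A) (m : ℕ) :
    (LinearMap.mulRight F (((LinearMap.mulLeft F x : Module.End F A) ^ m) x) : Module.End F A) =
      LinearMap.mulRight F x ^ (m + 1) :=
  map_pow_of_map_sq h h2 (LinearMap.mul F A).flip (fun y => by ext z; simp [(h y z).2]) x m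

/-- Left multiplication by an element is nilpotent once some power of it vanishes. -/
theorem isNilpotent_mulLeft (h : IsAlternative A) (h2 : (2 : F) ≠ 0) {x : A} {m : ℕ}
    (hx : ((LinearMap.mulLeft F x : Module.End F A) ^ m) x = 0) :
    IsNilpotent (LinearMap.mulLeft F x : Module.End F A) :=
  ⟨m + 1, by rw [← mulLeft_map_pow h h2, hx]; ext; simp⟩

end Powers

end IsAlternative

end Alternative

section LocalAlgebra

namespace IsAlternative

open Polynomial

variable {F B : Type*} [Field F] [NonUnitalNonAssocRing B] [Module F B] [SMulCommClass F B B]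
  [IsScalarTower F B B] {e : B}

theorem mulLeft_pow_unit (h : IsAlternative B) (h2 : (2 : F) ≠ 0)
    (he : ∀ x : B, e * x = x ∧ x * e = x) (x : B) (m : ℕ) :
    (LinearMap.mulLeft F (((LinearMap.mulLeft F x : Module.End F B) ^ m) e) : Module.End F B) =
      LinearMap.mulLeft F x ^ m := by
  cases m with
  | zero => ext z; simp [(he z).1]
  | succ m =>
    rw [pow_succ, Module.End.mul_apply, LinearMap.mulLeft_apply, (he x).2,
      mulLeft_map_pow h h2, pow_succ]

theorem mulRight_pow_unit (h : IsAlternative B) (h2 : (2 : F) ≠ 0)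
    (he : ∀ x : B, e * x = x ∧ x * e = x) (x : B) (m : ℕ) :
    (LinearMap.mulRight F (((LinearMap.mulLeft F x : Module.End F B) ^ m) e) : Module.End F B) =
      LinearMap.mulRight F x ^ m := by
  cases m with
  | zero => ext z; simp [(he z).2]
  | succ m =>
    rw [pow_succ, Module.End.mul_apply, LinearMap.mulLeft_apply, (he x).2,
      mulRight_map_pow h h2, pow_succ]

theorem mulLeft_aeval (h : IsAlternative B) (h2 : (2 : F) ≠ 0)
    (he : ∀ x : B, e * x = x ∧ x * e = x) (x : B) (p : F[X]) :
    (LinearMap.mulLeft F (aeval (LinearMap.mulLeft F x : Module.End F B) p e) : Module.End F B) =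
      aeval (LinearMap.mulLeft F x : Module.End F B) p := by
  induction p using Polynomial.induction_on' with
  | add p q hp hq =>
    ext z
    have h1 := LinearMap.congr_fun hp z
    have h3 := LinearMap.congr_fun hq z
    simp only [LinearMap.mulLeft_apply] at h1 h3
    simp [add_mul, h1, h3]
  | monomial n c =>
    have h1 := mulLeft_pow_unit h h2 he x n
    rw [aeval_monomial, ← Algebra.smul_def, LinearMap.smul_apply]
    conv_rhs => rw [← h1]
    ext z; simp [smul_mul_assoc]

theorem exists_isNilpotent_sub_smul_unit [IsAlgClosed F] [FiniteDimensional F B]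
    (h : IsAlternative B) (h2 : (2 : F) ≠ 0)
    (he : ∀ x : B, e * x = x ∧ x * e = x) (he0 : e ≠ 0)
    (hprim : ∀ f : B, f * f = f → f = 0 ∨ f = e) (x : B) :
    ∃ c : F, IsNilpotent (LinearMap.mulLeft F (x - c • e) : Module.End F B) := by
  have : Nontrivial B := ⟨⟨e, 0, he0⟩⟩
  set f : Module.End F B := LinearMap.mulLeft F x with hf
  obtain ⟨c, hc⟩ := Module.End.exists_eigenvalue f
  have hmin : minpoly F f ≠ 0 := minpoly.ne_zero (Algebra.IsIntegral.isIntegral f)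
  obtain ⟨q, hq, hndvd⟩ := exists_eq_pow_rootMultiplicity_mul_and_not_dvd (minpoly F f) hmin c
  set k := rootMultiplicity c (minpoly F f)
  have hcop : IsCoprime ((X - C c) ^ k) q :=
    IsCoprime.pow_left ((irreducible_X_sub_C c).coprime_iff_not_dvd.2 hndvd)
  obtain ⟨a, b, hab⟩ := hcop
  have hprod : aeval f ((X - C c) ^ k * q) = 0 := by rw [← hq]; exact minpoly.aeval F f
  have hLe : (LinearMap.mulLeft F e : Module.End F B) = 1 := by ext z; simp [(he z).1]
  have hXc : aeval f (X - C c) = (LinearMap.mulLeft F (x - c • e) : Module.End F B) := by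
    ext z; simp [hf, sub_mul, smul_mul_assoc, (he z).1]
  set E := aeval f (b * q) with hE
  have hEE : E * E = E := by
    have : b * q * (b * q) = b * q - a * b * ((X - C c) ^ k * q) := by
      linear_combination (b * q) * hab
    rw [hE, ← map_mul, this, map_sub, map_mul (aeval f) (a * b), hprod, mul_zero, sub_zero]
  have hLE : (LinearMap.mulLeft F (E e) : Module.End F B) = E := mulLeft_aeval h h2 he x _
  have hidem : E e * E e = E e := by
    conv_rhs => rw [← hEE]
    rw [Module.End.mul_apply, ← LinearMap.mulLeft_apply (R := F), hLE]
  refine ⟨c, ?_⟩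
  rw [← hXc]
  rcases hprim _ hidem with h0 | h1
  · exfalso
    rw [h0] at hLE
    have hE0 : E = 0 := by rw [← hLE]; ext z; simp
    have hone : aeval f a * (aeval f (X - C c)) ^ k = 1 := by
      have := congrArg (aeval f) hab
      rwa [map_add, ← hE, hE0, add_zero, map_mul, map_pow, map_one] at this
    obtain ⟨v, hv⟩ := hc.exists_hasEigenvector
    have hk : k ≠ 0 := (rootMultiplicity_pos hmin).2 (Module.End.isRoot_of_hasEigenvalue hc) |>.ne'
    have hv0 : (aeval f (X - C c)) v = 0 := by
      simp [hv.apply_eq_smul]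
    have hvk : ((aeval f (X - C c)) ^ k) v = 0 := by
      obtain ⟨j, hj⟩ := Nat.exists_eq_succ_of_ne_zero hk
      rw [hj, pow_succ, Module.End.mul_apply, hv0, map_zero]
    apply hv.2
    have := LinearMap.congr_fun hone v
    rw [Module.End.mul_apply, hvk, map_zero] at this
    exact this.symm
  · rw [h1, hLe] at hLE
    refine ⟨k, ?_⟩
    have h3 : aeval f ((X - C c) ^ k * (b * q)) = 0 := by
      rw [show (X - C c) ^ k * (b * q) = b * ((X - C c) ^ k * q) by ring, map_mul, hprod, mul_zero]
    rw [map_mul, ← hE, ← hLE, mul_one, map_pow] at h3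
    exact h3

theorem exists_inverse_of_isNilpotent_sub (h : IsAlternative B) (h2 : (2 : F) ≠ 0)
    (he : ∀ x : B, e * x = x ∧ x * e = x) {x : B} {c : F} (hc : c ≠ 0)
    (hx : IsNilpotent (LinearMap.mulLeft F (x - c • e) : Module.End F B)) :
    ∃ y : B, y * x = e ∧ x * y = e ∧
      (LinearMap.mulLeft F y : Module.End F B) * LinearMap.mulLeft F x = 1 := by
  obtain ⟨k, hk⟩ := hx
  set f : Module.End F B := LinearMap.mulLeft F x with hf
  have hXc : aeval f (X - C c) = (LinearMap.mulLeft F (x - c • e) : Module.End F B) := by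
    ext z; simp [hf, sub_mul, smul_mul_assoc, (he z).1]
  have hcop : IsCoprime ((X - C c) ^ k) X := by
    refine IsCoprime.pow_left ?_
    refine ⟨-C c⁻¹, C c⁻¹, ?_⟩
    have : C c⁻¹ * C c = (1 : F[X]) := by rw [← C_mul, inv_mul_cancel₀ hc, C_1]
    linear_combination this
  obtain ⟨a, b, hab⟩ := hcop
  have h1 : aeval f b * f = 1 := by
    have := congrArg (aeval f) hab
    rwa [map_add, map_mul, map_mul, map_pow, hXc, hk, mul_zero, zero_add, aeval_X, map_one] at this
  have h1' : f * aeval f b = 1 := by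
    have := (Commute.all X b).map (aeval f)
    rw [aeval_X] at this
    rw [this.eq, h1]
  have hL := mulLeft_aeval h h2 he x b
  refine ⟨aeval f b e, ?_, ?_, ?_⟩
  · have h3 := LinearMap.congr_fun h1 e
    rw [Module.End.mul_apply, hf, LinearMap.mulLeft_apply, (he x).2, ← hf, ← hL] at h3
    exact h3
  · rw [← LinearMap.mulLeft_apply (R := F) x, ← hf, ← Module.End.mul_apply, h1']
    rfl
  · rw [hL, h1]

theorem not_injective_mulLeft_mul (h : IsAlternative B) (h2 : (2 : F) ≠ 0)
    (he : ∀ x : B, e * x = x ∧ x * e = x) (he0 : e ≠ 0) {x : B}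
    (hx : IsNilpotent (LinearMap.mulLeft F x : Module.End F B)) (y : B) :
    ∃ z, z ≠ 0 ∧ y * x * z = 0 := by
  classical
  set f : Module.End F B := LinearMap.mulLeft F x with hf
  have hex : ∃ m, (f ^ m) e = 0 := by
    obtain ⟨k, hk⟩ := hx
    exact ⟨k, by rw [hk]; rfl⟩
  have hspec := Nat.find_spec hex
  obtain ⟨m, hm⟩ : ∃ m, Nat.find hex = m + 1 := by
    refine Nat.exists_eq_succ_of_ne_zero fun h0 => he0 ?_
    rw [h0] at hspec
    simpa using hspec
  refine ⟨(f ^ m) e, Nat.find_min hex (by omega), ?_⟩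
  rw [hm] at hspec
  have e1 := mulRight_pow_unit h h2 he x m
  have e2 := mulRight_pow_unit h h2 he x (m + 1)
  rw [← hf] at e1 e2
  rw [hspec] at e2
  have e3 : y * x * (f ^ m) e = (LinearMap.mulRight F x ^ (m + 1) : Module.End F B) y := by
    rw [← LinearMap.mulRight_apply (R := F), e1, ← LinearMap.mulRight_apply (R := F) x y,
      ← Module.End.mul_apply, pow_succ]
  rw [e3, ← e2]
  simp

/-- A finite-dimensional unital alternative algebra without nontrivial idempotents over an
algebraically closed field has a character whose kernel consists of nilpotent elements. -/
theorem exists_character [IsAlgClosed F] [FiniteDimensional F B]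
    (h : IsAlternative B) (h2 : (2 : F) ≠ 0)
    (he : ∀ x : B, e * x = x ∧ x * e = x) (he0 : e ≠ 0)
    (hprim : ∀ f : B, f * f = f → f = 0 ∨ f = e) :
    ∃ t : B →ₗ[F] F, t e = 1 ∧ (∀ x y, t (x * y) = t x * t y) ∧
      (∀ x, t x = 0 → ∃ m, ((LinearMap.mulLeft F x : Module.End F B) ^ m) x = 0) ∧
      ∀ x, t x ≠ 0 → ∃ y, y * x = e ∧ x * y = e := by
  have : Nontrivial B := ⟨⟨e, 0, he0⟩⟩
  let nil : B → Prop := fun x => IsNilpotent (LinearMap.mulLeft F x : Module.End F B)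
  have hex : ∀ x, ∃ c : F, nil (x - c • e) := exists_isNilpotent_sub_smul_unit h h2 he he0 hprim
  have hsmul : ∀ (c : F) x, nil x → nil (c • x) := by
    intro c x hx
    have : (LinearMap.mulLeft F (c • x) : Module.End F B) = c • LinearMap.mulLeft F x := by
      ext z; simp [smul_mul_assoc]
    change IsNilpotent _
    rw [this]
    exact hx.smul c
  have hmul : ∀ x y, nil x → nil (y * x) := by
    intro x y hx
    obtain ⟨c, hc⟩ := hex (y * x)
    by_cases hc0 : c = 0
    · simpa [hc0] using hc
    · exfalso
      obtain ⟨w, -, -, hw⟩ := exists_inverse_of_isNilpotent_sub h h2 he hc0 hc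
      obtain ⟨z, hz0, hz⟩ := not_injective_mulLeft_mul h h2 he he0 hx y
      apply hz0
      have := congrArg (fun g : Module.End F B => g z) hw
      simpa [Module.End.mul_apply, hz] using this.symm
  have hunit : ∀ x, nil x → ¬ nil (e - x) := by
    intro x hx hx'
    have h1 : (LinearMap.mulLeft F (e - x) : Module.End F B) = 1 - LinearMap.mulLeft F x := by
      ext z; simp [sub_mul, (he z).1]
    have h3 : IsUnit (LinearMap.mulLeft F (e - x) : Module.End F B) := by
      rw [h1]; exact IsNilpotent.isUnit_one_sub hx
    exact hx'.not_isUnit h3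
  have hadd : ∀ x y, nil x → nil y → nil (x + y) := by
    intro x y hx hy
    obtain ⟨c, hc⟩ := hex (x + y)
    by_cases hc0 : c = 0
    · simpa [hc0] using hc
    · exfalso
      obtain ⟨w, hw, -, -⟩ := exists_inverse_of_isNilpotent_sub h h2 he hc0 hc
      have h1 : e - w * x = w * y := by rw [← hw, mul_add]; abel
      exact hunit (w * x) (hmul x w hx) (h1 ▸ hmul y w hy)
  have hzero : ∀ c : F, nil (c • e) → c = 0 := by
    intro c hc
    by_contra hc0
    have h1 := hsmul c⁻¹ _ hc
    rw [smul_smul, inv_mul_cancel₀ hc0, one_smul] at h1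
    refine hunit e h1 ?_
    rw [sub_self]
    exact ⟨1, by ext z; simp⟩
  choose t ht using hex
  have huniq : ∀ x (c : F), nil (x - c • e) → t x = c := by
    intro x c hc
    have h1 := hadd _ _ hc (hsmul (-1) _ (ht x))
    rw [show x - c • e + (-1 : F) • (x - t x • e) = (t x - c) • e by module] at h1
    exact sub_eq_zero.1 (hzero _ h1)
  have tadd : ∀ x y, t (x + y) = t x + t y := by
    intro x y
    refine huniq _ _ ?_
    rw [show x + y - (t x + t y) • e = (x - t x • e) + (y - t y • e) by rw [add_smul]; abel]
    exact hadd _ _ (ht x) (ht y)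
  have tsmul : ∀ (c : F) x, t (c • x) = c • t x := by
    intro c x
    refine huniq _ _ ?_
    rw [show c • x - (c • t x) • e = c • (x - t x • e) by rw [smul_sub, smul_assoc]]
    exact hsmul _ _ (ht x)
  have tmul : ∀ x y, t (x * y) = t x * t y := by
    intro x y
    refine huniq _ _ ?_
    have : x * y - (t x * t y) • e = x * (y - t y • e) + t y • (x - t x • e) := by
      rw [mul_sub, mul_smul_comm, (he x).2, smul_sub, smul_smul, mul_comm (t y)]; abel
    rw [this]
    exact hadd _ _ (hmul _ _ (ht y)) (hsmul _ _ (ht x))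
  refine ⟨⟨⟨t, tadd⟩, tsmul⟩, ?_, tmul, ?_, ?_⟩
  · refine huniq _ _ ?_
    rw [one_smul, sub_self]
    exact ⟨1, by ext z; simp⟩
  · intro x hx
    have h1 : nil x := by
      have := ht x
      change t x = 0 at hx
      simpa [hx] using this
    obtain ⟨k, hk⟩ := h1
    exact ⟨k, by rw [hk]; rfl⟩
  · intro x hx
    obtain ⟨y, h1, h3, -⟩ := exists_inverse_of_isNilpotent_sub h h2 he hx (ht x)
    exact ⟨y, h1, h3⟩

end IsAlternative

end LocalAlgebra

section Peirce

set_option linter.unusedSectionVars false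

theorem eq_zero_of_add_self_eq_zero {F M : Type*} [Field F] [AddCommGroup M] [Module F M]
    (h2 : (2 : F) ≠ 0) {x : M} (hx : x + x = 0) : x = 0 := by
  rw [← two_smul F] at hx
  exact (smul_eq_zero.1 hx).resolve_left h2

namespace IsAlternative

theorem mul_mul_left_expand {A : Type*} [NonUnitalNonAssocRing A] (h : IsAlternative A)
    (f x y : A) : f * (x * y) = f * x * y + x * f * y - x * (f * y) := by
  have := h.left_linearized f x y
  grind

theorem mul_mul_right_expand {A : Type*} [NonUnitalNonAssocRing A] (h : IsAlternative A)
    (f x y : A) : x * y * f = x * (y * f) + x * (f * y) - x * f * y := by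
  have := h.right_linearized x y f
  grind

section Orthogonal

variable {F A : Type*} [Field F] [NonUnitalNonAssocRing A] [Module F A]

theorem mul_mul_eq_zero_of_orthogonal (h : IsAlternative A) (h2 : (2 : F) ≠ 0) {f g : A}
    (hf : f * f = f) (hfg : f * g = 0) (hgf : g * f = 0) (x : A) : f * (g * x) = 0 := by
  have e1 := h.left_linearized f g x
  have e2 := h.left_linearized f g (f * x)
  have e3 := (h f (g * x)).1
  have e4 := (h f x).1
  have e5 : f * (g * (f * x)) = - (f * (f * (g * x))) := by
    rw [← mul_neg]; congr 1
    simp only [hfg, hgf, zero_mul, add_zero] at e1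
    grind
  simp only [hfg, hgf, zero_mul, add_zero] at e1 e2
  rw [hf] at e3 e4
  rw [← e4] at e2
  rw [← e3] at e5
  refine eq_zero_of_add_self_eq_zero h2 ?_
  grind

theorem mul_mul_eq_zero_of_orthogonal' (h : IsAlternative A) (h2 : (2 : F) ≠ 0) {f g : A}
    (hf : f * f = f) (hfg : f * g = 0) (hgf : g * f = 0) (x : A) : x * g * f = 0 := by
  have e1 := h.right_linearized x f g
  have e2 := h.right_linearized (x * f) f g
  have e3 := (h f (x * g)).2
  have e4 := (h f x).2
  have e5 : x * f * g * f = - (x * g * f * f) := by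
    rw [← neg_mul]; congr 1
    simp only [hfg, hgf, mul_zero, add_zero] at e1
    grind
  simp only [hfg, hgf, mul_zero, add_zero] at e1 e2
  rw [hf] at e3 e4
  rw [e4] at e2
  rw [e3] at e5
  refine eq_zero_of_add_self_eq_zero h2 ?_
  grind

end Orthogonal

end IsAlternative

/-- A complete system of pairwise orthogonal primitive idempotents. -/
structure IsPeirceSystem {A ι : Type*} [NonAssocRing A] [Fintype ι] (e : ι → A) : Prop where
  mul_self : ∀ i, e i * e i = e i
  mul_of_ne : ∀ i j, i ≠ j → e i * e j = 0
  sum_eq_one : ∑ i, e i = 1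
  ne_zero : ∀ i, e i ≠ 0
  primitive : ∀ i f, f * f = f → e i * f = f → f * e i = f → f = 0 ∨ f = e i

/-- The Peirce space of elements fixed by `e i` on the left and by `e j` on the right. -/
def peirceSpace (F : Type*) {A ι : Type*} [Field F] [NonAssocRing A] [Module F A]
    [SMulCommClass F A A] [IsScalarTower F A A] (e : ι → A) (i j : ι) : Submodule F A where
  carrier := {x | e i * x = x ∧ x * e j = x}
  add_mem' := by
    rintro x y ⟨h1, h2⟩ ⟨h3, h4⟩
    exact ⟨by rw [mul_add, h1, h3], by rw [add_mul, h2, h4]⟩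
  zero_mem' := ⟨mul_zero _, zero_mul _⟩
  smul_mem' := by
    rintro c x ⟨h1, h2⟩
    exact ⟨by rw [mul_smul_comm, h1], by rw [smul_mul_assoc, h2]⟩

variable {F A : Type*} [Field F] [NonAssocRing A] [Module F A]
  [SMulCommClass F A A] [IsScalarTower F A A]

theorem exists_isPeirceSystem [FiniteDimensional F A] (h : IsAlternative A) (h2 : (2 : F) ≠ 0)
    [Nontrivial A] : ∃ T : Finset A, IsPeirceSystem (fun x : T => (x : A)) := by
  classical
  let good : Finset A → Prop := fun T => 0 ∉ T ∧ (∀ x ∈ T, x * x = x) ∧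
    (∀ x ∈ T, ∀ y ∈ T, x ≠ y → x * y = 0) ∧ ∑ x ∈ T, x = 1
  have hbound : ∀ T, good T → T.card ≤ Module.finrank F A := by
    rintro T ⟨h0, h1, h3, -⟩
    have hli : LinearIndependent F (fun x : T => (x : A)) := by
      rw [Fintype.linearIndependent_iff]
      intro g hg y
      have := congrArg (fun z => z * (y : A)) hg
      simp only [Finset.sum_mul, zero_mul, smul_mul_assoc] at this
      rw [Finset.sum_eq_single y, h1 _ y.2] at this
      · exact (smul_eq_zero.1 this).resolve_right fun hy => h0 (hy ▸ y.2)
      · intro b _ hb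
        rw [h3 _ b.2 _ y.2 (fun hne => hb (Subtype.ext hne)), smul_zero]
      · simp
    simpa using hli.fintype_card_le_finrank
  have hex : ∃ n, ∃ T, good T ∧ T.card = n := by
    refine ⟨_, {1}, ⟨by simp, by simp, ?_, by simp⟩, rfl⟩
    intro x hx y hy hxy
    simp_all
  obtain ⟨T, hT, hmax⟩ : ∃ T, good T ∧ ∀ T', good T' → T'.card ≤ T.card := by
    obtain ⟨T0, hT0, hc0⟩ := hex.choose_spec
    have hP : ∃ T, good T ∧ T.card =
        Nat.findGreatest (fun n => ∃ T, good T ∧ T.card = n) (Module.finrank F A) :=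
      Nat.findGreatest_spec (P := fun n => ∃ T, good T ∧ T.card = n) (hbound T0 hT0)
        ⟨T0, hT0, rfl⟩
    obtain ⟨T, hT, hc⟩ := hP
    refine ⟨T, hT, fun T' hT' => ?_⟩
    rw [hc]
    exact Nat.le_findGreatest (P := fun n => ∃ T, good T ∧ T.card = n) (hbound T' hT')
      ⟨T', hT', rfl⟩
  obtain ⟨h0, h1, h3, h4⟩ := hT
  refine ⟨T, fun i => h1 _ i.2, fun i j hij => h3 _ i.2 _ j.2 fun hne => hij (Subtype.ext hne),
    ?_, fun i hi => h0 (hi ▸ i.2), ?_⟩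
  · rw [← h4, Finset.sum_coe_sort T (fun x => x)]
  · rintro ⟨e, he⟩ f hff hef hfe
    change e * f = f at hef
    change f * e = f at hfe
    change f = 0 ∨ f = e
    by_contra! hne
    have hee := h1 e he
    have hfg : ∀ g ∈ T, g ≠ e → f * g = 0 ∧ g * f = 0 := by
      intro g hg hge
      constructor
      · rw [← hfe]
        exact h.mul_mul_eq_zero_of_orthogonal' h2 (h1 g hg) (h3 _ hg _ he hge)
          (h3 _ he _ hg hge.symm) f
      · rw [← hef]
        exact h.mul_mul_eq_zero_of_orthogonal h2 (h1 g hg) (h3 _ hg _ he hge)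
          (h3 _ he _ hg hge.symm) f
    have hcc : (e - f) * (e - f) = e - f := by
      simp only [mul_sub, sub_mul, hee, hff, hef, hfe]; abel
    have hfT : f ∉ T.erase e := by
      intro hf
      rw [Finset.mem_erase] at hf
      exact hne.1 (hff ▸ (hfg f hf.2 hf.1).1)
    have hcT : e - f ∉ T.erase e := by
      intro hf
      rw [Finset.mem_erase] at hf
      have h5 := hfg _ hf.2 hf.1
      have h6 := h3 _ he _ hf.2 hf.1.symm
      rw [sub_mul, h6, h5.1, sub_zero] at hcc
      exact hne.2 (sub_eq_zero.1 hcc.symm).symm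
    have hfc : f ≠ e - f := by
      intro hc
      have : f * f = f * (e - f) := congrArg (fun z => f * z) hc
      rw [mul_sub, hfe, hff, sub_self] at this
      exact hne.1 this
    have hgood : good (insert f (insert (e - f) (T.erase e))) := by
      refine ⟨?_, ?_, ?_, ?_⟩
      · simp only [Finset.mem_insert, Finset.mem_erase, not_or]
        exact ⟨fun h5 => hne.1 h5.symm, fun h5 => hne.2 (sub_eq_zero.1 h5.symm).symm,
          fun h5 => h0 h5.2⟩
      · simp only [Finset.mem_insert, Finset.mem_erase]
        rintro x (rfl | rfl | hx)
        exacts [hff, hcc, h1 x hx.2]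
      · have h7 : ∀ g ∈ T, g ≠ e → (e - f) * g = 0 ∧ g * (e - f) = 0 := fun g hg hge => by
          rw [sub_mul, mul_sub, (hfg g hg hge).1, (hfg g hg hge).2, h3 _ he _ hg hge.symm,
            h3 _ hg _ he hge]
          simp
        have h8 : f * (e - f) = 0 := by rw [mul_sub, hfe, hff, sub_self]
        have h9 : (e - f) * f = 0 := by rw [sub_mul, hef, hff, sub_self]
        simp only [Finset.mem_insert, Finset.mem_erase]
        rintro x (rfl | rfl | hx) y (rfl | rfl | hy) hxy
        · exact absurd rfl hxy
        · exact h8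
        · exact (hfg y hy.2 hy.1).1
        · exact h9
        · exact absurd rfl hxy
        · exact (h7 y hy.2 hy.1).1
        · exact (hfg x hx.2 hx.1).2
        · exact (h7 x hx.2 hx.1).2
        · exact h3 _ hx.2 _ hy.2 hxy
      · rw [Finset.sum_insert (by simp only [Finset.mem_insert, not_or]; exact ⟨hfc, hfT⟩),
          Finset.sum_insert hcT, ← add_assoc, add_sub_cancel,
          Finset.add_sum_erase T (fun x => x) he, h4]
    have h10 := hmax _ hgood
    rw [Finset.card_insert_of_notMem (by simp only [Finset.mem_insert, not_or]; exact ⟨hfc, hfT⟩),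
      Finset.card_insert_of_notMem hcT, Finset.card_erase_of_mem he] at h10
    have := Finset.card_pos.2 ⟨e, he⟩
    omega

namespace IsPeirceSystem

variable {ι : Type*} [Fintype ι] {e : ι → A}

local notation "P" => peirceSpace F e

section Basic

theorem unit_mem (H : IsPeirceSystem e) (i : ι) : e i ∈ P i i := ⟨H.mul_self i, H.mul_self i⟩

variable (h : IsAlternative A) (h2 : (2 : F) ≠ 0) (H : IsPeirceSystem e)
include h h2 H

theorem unit_mul {i j k : ι} {x : A} (hx : x ∈ P i j) (hk : k ≠ i) : e k * x = 0 := by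
  rw [← hx.1]
  exact h.mul_mul_eq_zero_of_orthogonal h2 (H.mul_self k) (H.mul_of_ne _ _ hk)
    (H.mul_of_ne _ _ hk.symm) x

theorem mul_unit {i j k : ι} {x : A} (hx : x ∈ P i j) (hk : k ≠ j) : x * e k = 0 := by
  rw [← hx.2]
  exact h.mul_mul_eq_zero_of_orthogonal' h2 (H.mul_self k) (H.mul_of_ne _ _ hk)
    (H.mul_of_ne _ _ hk.symm) x

theorem eq_zero_of_mem_of_ne {i j k l : ι} {x : A} (hx : x ∈ P i j) (hx' : x ∈ P k l)
    (hne : i ≠ k ∨ j ≠ l) : x = 0 := by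
  rcases hne with hne | hne
  · rw [← hx.1]; exact unit_mul h h2 H hx' hne
  · rw [← hx.2]; exact mul_unit h h2 H hx' hne

theorem unit_mul_mul_unit (i j : ι) (x : A) : e i * x * e j = e i * (x * e j) := by
  by_cases hij : i = j
  · rw [hij]; exact h.flexible _ _
  · have h1 := h.left_linearized (e i) x (e j)
    have h3 := h.mul_mul_eq_zero_of_orthogonal' h2 (H.mul_self j) (H.mul_of_ne _ _ (Ne.symm hij))
      (H.mul_of_ne _ _ hij) x
    rw [h3, H.mul_of_ne _ _ hij, mul_zero, add_zero, add_zero] at h1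
    exact h1

theorem component_mem (i j : ι) (x : A) : e i * (x * e j) ∈ P i j := by
  constructor
  · rw [← (h _ _).1, H.mul_self]
  · rw [← unit_mul_mul_unit h h2 H, (h _ _).2, H.mul_self]

theorem sum_component (x : A) : ∑ i, ∑ j, e i * (x * e j) = x := by
  simp_rw [← Finset.mul_sum]
  rw [← Finset.sum_mul, H.sum_eq_one, one_mul, mul_one]

theorem induction_on {p : A → Prop} (x : A) (h0 : p 0) (hadd : ∀ x y, p x → p y → p (x + y))
    (hp : ∀ i j, ∀ x ∈ P i j, p x) : p x := by
  rw [← sum_component h h2 H x]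
  exact Finset.sum_induction _ _ hadd h0 fun i _ =>
    Finset.sum_induction _ _ hadd h0 fun j _ => hp i j _ (component_mem h h2 H i j x)

theorem mul_mem {i j l : ι} {x y : A} (hx : x ∈ P i j) (hy : y ∈ P j l) : x * y ∈ P i l := by
  constructor
  · rw [h.mul_mul_left_expand, hx.1]
    by_cases hij : i = j
    · subst hij; rw [hx.2, hy.1]; abel
    · rw [mul_unit h h2 H hx hij, unit_mul h h2 H hy hij]; simp
  · rw [h.mul_mul_right_expand, hy.2]
    by_cases hij : l = j
    · subst hij; rw [hx.2, hy.1]; abel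
    · rw [mul_unit h h2 H hx hij, unit_mul h h2 H hy hij]; simp

theorem mul_mem_swap {i j : ι} (hij : i ≠ j) {x y : A} (hx : x ∈ P i j) (hy : y ∈ P i j) :
    x * y ∈ P j i := by
  constructor
  · rw [h.mul_mul_left_expand, hx.2, unit_mul h h2 H hx hij.symm, unit_mul h h2 H hy hij.symm]; simp
  · rw [h.mul_mul_right_expand, hy.1, mul_unit h h2 H hy hij, mul_unit h h2 H hx hij]; simp

theorem mul_eq_zero {i j k l : ι} (hjk : j ≠ k) (hne : ¬ (i = k ∧ j = l)) {x y : A}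
    (hx : x ∈ P i j) (hy : y ∈ P k l) : x * y = 0 := by
  by_cases hik : i = k
  · have hjl : j ≠ l := fun hjl => hne ⟨hik, hjl⟩
    have e1 := h.mul_mul_right_expand (e j) x y
    rw [mul_unit h h2 H hy hjl, unit_mul h h2 H hy hjk, hx.2] at e1
    have e2 := (h (e j) (x * y)).2
    rw [H.mul_self, e1] at e2
    simp only [mul_zero, add_zero, zero_sub, neg_mul, e1] at e2
    refine eq_zero_of_add_self_eq_zero h2 ?_
    grind
  · have e1 := h.mul_mul_left_expand (e k) x y
    rw [unit_mul h h2 H hx (Ne.symm hik), mul_unit h h2 H hx hjk.symm, hy.1] at e1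
    have e2 := (h (e k) (x * y)).1
    rw [H.mul_self, e1] at e2
    simp only [zero_mul, zero_add, zero_sub, mul_neg, e1] at e2
    refine eq_zero_of_add_self_eq_zero h2 ?_
    grind

theorem mul_self_eq_zero {i j : ι} (hij : i ≠ j) {x : A} (hx : x ∈ P i j) : x * x = 0 := by
  have h1 := (mul_mem_swap h h2 H hij hx hx).1
  have h3 := (h x (e i)).1
  rw [mul_unit h h2 H hx hij, mul_zero, (mul_mem_swap h h2 H hij hx hx).2] at h3
  exact h3

theorem mul_anticomm {i j : ι} (hij : i ≠ j) {x y : A} (hx : x ∈ P i j) (hy : y ∈ P i j) :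
    y * x = -(x * y) := by
  have h1 := mul_self_eq_zero h h2 H hij ((P i j).add_mem hx hy)
  simp only [mul_add, add_mul, mul_self_eq_zero h h2 H hij hx,
    mul_self_eq_zero h h2 H hij hy] at h1
  grind

theorem mul_assoc_of_mem {i j k l : ι} (hne : ¬ (k = i ∧ l = j)) {a b c : A}
    (ha : a ∈ P i j) (hb : b ∈ P j k) (hc : c ∈ P k l) : a * b * c = a * (b * c) := by
  have e1 := h.cyclic a b c
  rw [← sub_eq_zero]
  by_cases hli : l = i
  · subst hli
    have m1 := (P l l).sub_mem (mul_mem h h2 H (mul_mem h h2 H ha hb) hc)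
      (mul_mem h h2 H ha (mul_mem h h2 H hb hc))
    by_cases hij : l = j
    · subst hij
      have hk : l ≠ k := fun hk => hne ⟨hk.symm, rfl⟩
      have m2 := (P k k).sub_mem (mul_mem h h2 H (mul_mem h h2 H hc ha) hb)
        (mul_mem h h2 H hc (mul_mem h h2 H ha hb))
      rw [h.cyclic c a b] at m2
      exact eq_zero_of_mem_of_ne h h2 H m1 m2 (Or.inl hk)
    · have m2 := (P j j).sub_mem (mul_mem h h2 H (mul_mem h h2 H hb hc) ha)
        (mul_mem h h2 H hb (mul_mem h h2 H hc ha))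
      rw [← e1] at m2
      exact eq_zero_of_mem_of_ne h h2 H m1 m2 (Or.inl hij)
  · rw [e1, mul_eq_zero h h2 H (x := b * c) hli (by rintro ⟨rfl, rfl⟩; exact hli rfl)
      (mul_mem h h2 H hb hc) ha, mul_eq_zero h h2 H hli hne hc ha, mul_zero, sub_zero]

theorem mul_mul_cyclic {i j : ι} (hij : i ≠ j) {x y z : A} (hx : x ∈ P i j) (hy : y ∈ P i j)
    (hz : z ∈ P i j) : x * y * z = y * z * x ∧ x * (y * z) = y * (z * x) := by
  have e1 := h.cyclic x y z
  have s := @mul_mem_swap _ _ _ _ _ _ _ _ _ _ h h2 H _ _ hij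
  have m1 := (P j j).sub_mem (mul_mem h h2 H (s hx hy) hz) (mul_mem h h2 H (s hy hz) hx)
  have m2 := (P i i).sub_mem (mul_mem h h2 H hx (s hy hz)) (mul_mem h h2 H hy (s hz hx))
  have e2 : x * y * z - y * z * x = x * (y * z) - y * (z * x) := by grind
  constructor
  · rw [← sub_eq_zero]
    exact eq_zero_of_mem_of_ne h h2 H m1 (e2 ▸ m2) (Or.inl hij.symm)
  · rw [← sub_eq_zero]
    exact eq_zero_of_mem_of_ne h h2 H m2 (e2 ▸ m1) (Or.inl hij)

end Basic

end IsPeirceSystem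

end Peirce

section Trace

set_option linter.unusedSectionVars false

variable {F A ι : Type*} [Field F] [NonAssocRing A] [Module F A]
  [SMulCommClass F A A] [IsScalarTower F A A] [Fintype ι] {e : ι → A}

local notation "P" => peirceSpace F e

/-- A two-sided ideal of a nonassociative algebra. -/
def IsTwoSidedIdeal {F A : Type*} [Field F] [NonUnitalNonAssocRing A] [Module F A]
    (I : Submodule F A) : Prop :=
  ∀ x ∈ I, ∀ u, u * x ∈ I ∧ x * u ∈ I

/-- A family of characters of the diagonal Peirce spaces, with nilpotent kernels. -/
structure IsPeirceCharacter (e : ι → A) (t : ι → A →ₗ[F] F) : Prop where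
  unit : ∀ i, t i (e i) = 1
  eq_zero : ∀ i j k x, x ∈ peirceSpace F e j k → ¬ (j = i ∧ k = i) → t i x = 0
  mul : ∀ i, ∀ x ∈ peirceSpace F e i i, ∀ y ∈ peirceSpace F e i i, t i (x * y) = t i x * t i y
  nilpotent : ∀ i, ∀ x ∈ peirceSpace F e i i, t i x = 0 →
    ∃ m, ((LinearMap.mulLeft F x : Module.End F A) ^ m) x = 0
  inverse : ∀ i, ∀ x ∈ peirceSpace F e i i, t i x ≠ 0 →
    ∃ y ∈ peirceSpace F e i i, y * x = e i ∧ x * y = e i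

namespace IsPeirceSystem

theorem exists_isPeirceCharacter [IsAlgClosed F] [FiniteDimensional F A] (h : IsAlternative A)
    (h2 : (2 : F) ≠ 0) (H : IsPeirceSystem e) :
    ∃ t : ι → A →ₗ[F] F, IsPeirceCharacter e t := by
  have key : ∀ i, ∃ t : A →ₗ[F] F, t (e i) = 1 ∧
      (∀ j k x, x ∈ P j k → ¬ (j = i ∧ k = i) → t x = 0) ∧
      (∀ x ∈ P i i, ∀ y ∈ P i i, t (x * y) = t x * t y) ∧
      (∀ x ∈ P i i, t x = 0 → ∃ m, ((LinearMap.mulLeft F x : Module.End F A) ^ m) x = 0) ∧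
      ∀ x ∈ P i i, t x ≠ 0 → ∃ y ∈ P i i, y * x = e i ∧ x * y = e i := by
    intro i
    let C : NonUnitalSubalgebra F A :=
      { P i i with mul_mem' := fun ha hb => mul_mem h h2 H ha hb }
    have hC : ∀ x, x ∈ C ↔ x ∈ P i i := fun x => Iff.rfl
    let u : C := ⟨e i, H.unit_mem (F := F) i⟩
    have hCalt : IsAlternative C := fun x y =>
      ⟨Subtype.ext (h x y).1, Subtype.ext (h x y).2⟩
    have hu : ∀ x : C, u * x = x ∧ x * u = x := fun x =>
      ⟨Subtype.ext x.2.1, Subtype.ext x.2.2⟩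
    have hu0 : u ≠ 0 := fun h0 => H.ne_zero i (congrArg Subtype.val h0)
    have hprim : ∀ f : C, f * f = f → f = 0 ∨ f = u := by
      intro f hf
      rcases H.primitive i f (congrArg Subtype.val hf) f.2.1 f.2.2 with h0 | h0
      · exact Or.inl (Subtype.ext h0)
      · exact Or.inr (Subtype.ext h0)
    have hfd : FiniteDimensional F C :=
      inferInstanceAs (FiniteDimensional F (P i i))
    obtain ⟨t, ht1, ht2, ht3, ht4⟩ := IsAlternative.exists_character hCalt h2 hu hu0 hprim
    let pr : A →ₗ[F] C :=
      { toFun := fun x => ⟨e i * (x * e i), component_mem h h2 H i i x⟩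
        map_add' := fun x y => Subtype.ext (by simp [add_mul, mul_add])
        map_smul' := fun c x => Subtype.ext (by simp [smul_mul_assoc, mul_smul_comm]) }
    have hpr : ∀ x (hx : x ∈ P i i), pr x = ⟨x, hx⟩ := fun x hx =>
      Subtype.ext (by change e i * (x * e i) = x; rw [hx.2, hx.1])
    refine ⟨t ∘ₗ pr, ?_, ?_, ?_, ?_, ?_⟩
    · rw [LinearMap.comp_apply, hpr _ (H.unit_mem i)]
      exact ht1
    · intro j k x hx hne
      have : pr x = 0 := by
        refine Subtype.ext ?_
        change e i * (x * e i) = 0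
        by_cases hk : i = k
        · subst hk
          rw [hx.2]
          exact unit_mul h h2 H hx (fun hj => hne ⟨hj.symm, rfl⟩)
        · rw [mul_unit h h2 H hx hk, mul_zero]
      rw [LinearMap.comp_apply, this, map_zero]
    · intro x hx y hy
      simp only [LinearMap.comp_apply, hpr _ hx, hpr _ hy, hpr _ (mul_mem h h2 H hx hy)]
      exact ht2 ⟨x, hx⟩ ⟨y, hy⟩
    · intro x hx hx0
      rw [LinearMap.comp_apply, hpr _ hx] at hx0
      obtain ⟨m, hm⟩ := ht3 _ hx0
      refine ⟨m, ?_⟩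
      have hpow : ∀ m,
          ((((LinearMap.mulLeft F (⟨x, hx⟩ : C) : Module.End F C) ^ m) ⟨x, hx⟩ : C) : A)
          = ((LinearMap.mulLeft F x : Module.End F A) ^ m) x := by
        intro m
        induction m with
        | zero => simp
        | succ m ih =>
          rw [pow_succ', pow_succ', Module.End.mul_apply, Module.End.mul_apply, ← ih]
          rfl
      rw [← hpow, hm]; rfl
    · intro x hx hx0
      rw [LinearMap.comp_apply, hpr _ hx] at hx0
      obtain ⟨y, h3, h4⟩ := ht4 _ hx0
      exact ⟨y, y.2, congrArg Subtype.val h3, congrArg Subtype.val h4⟩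
  choose t ht using key
  exact ⟨t, fun i => (ht i).1, fun i => (ht i).2.1, fun i => (ht i).2.2.1,
    fun i => (ht i).2.2.2.1, fun i => (ht i).2.2.2.2⟩

end IsPeirceSystem

namespace IsPeirceCharacter

open IsPeirceSystem

variable {t : ι → A →ₗ[F] F} (h : IsAlternative A) (h2 : (2 : F) ≠ 0) (H : IsPeirceSystem e)
  (T : IsPeirceCharacter e t)
include h h2 H T

theorem mul_swap {i j : ι} {x y : A} (hx : x ∈ P i j) (hy : y ∈ P j i) :
    t i (x * y) = t j (y * x) := by
  by_cases hij : i = j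
  · subst hij
    rw [T.mul i x hx y hy, T.mul i y hy x hx, mul_comm]
  by_contra hne
  set a := x * y with ha
  set b := y * x with hb
  have haP : a ∈ P i i := mul_mem h h2 H hx hy
  have hbP : b ∈ P j j := mul_mem h h2 H hy hx
  set n := a - t i a • e i with hn
  set d := b - t i a • e j with hd
  have hnP : n ∈ P i i := (P i i).sub_mem haP ((P i i).smul_mem _ (H.unit_mem i))
  have hdP : d ∈ P j j := (P j j).sub_mem hbP ((P j j).smul_mem _ (H.unit_mem j))
  have hn0 : t i n = 0 := by rw [hn, map_sub, map_smul, T.unit]; simp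
  have hd0 : t j d ≠ 0 := by
    rw [hd, map_sub, map_smul, T.unit, smul_eq_mul, mul_one]
    exact fun h0 => hne (sub_eq_zero.1 h0).symm
  obtain ⟨c, hcP, -, hdc⟩ := T.inverse j d hdP hd0
  obtain ⟨m, hm⟩ := T.nilpotent i n hnP hn0
  obtain ⟨k, hk⟩ := IsAlternative.isNilpotent_mulLeft h h2 hm
  have hnx : n * x = x * d := by
    rw [hn, hd, sub_mul, mul_sub, smul_mul_assoc, mul_smul_comm, hx.1, hx.2, ha, hb, h.flexible]
  have hxc : n * x * c = x := by
    rw [hnx, mul_assoc_of_mem h h2 H (fun hh => hij hh.1.symm) hx hdP hcP, hdc, hx.2]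
  have hmem : ∀ m, ∀ z ∈ P i j, ((LinearMap.mulLeft F n : Module.End F A) ^ m) z ∈ P i j ∧
      ((LinearMap.mulLeft F n : Module.End F A) ^ m) (z * c) =
        ((LinearMap.mulLeft F n : Module.End F A) ^ m) z * c := by
    intro m z hz
    induction m with
    | zero => exact ⟨hz, rfl⟩
    | succ m ih =>
      simp only [pow_succ', Module.End.mul_apply, LinearMap.mulLeft_apply, ih.2]
      exact ⟨mul_mem h h2 H hnP ih.1,
        (mul_assoc_of_mem h h2 H (fun hh => hij hh.1.symm) hnP ih.1 hcP).symm⟩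
  have hdown : ∀ m, ((LinearMap.mulLeft F n : Module.End F A) ^ m) x = 0 → x = 0 := by
    intro m
    induction m with
    | zero => exact fun hx0 => hx0
    | succ m ih =>
      intro h0
      refine ih ?_
      rw [← hxc, (hmem m _ (mul_mem h h2 H hnP hx)).2]
      rw [pow_succ, Module.End.mul_apply, LinearMap.mulLeft_apply] at h0
      rw [h0, zero_mul]
  have hx0 : x = 0 := hdown k (by rw [hk]; rfl)
  apply hne
  rw [ha, hb, hx0]; simp

theorem trace_of_mem_diag {i : ι} {x : A} (hx : x ∈ P i i) : (∑ j, t j) x = t i x := by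
  rw [LinearMap.sum_apply, Finset.sum_eq_single i]
  · intro j _ hj
    exact T.eq_zero j i i x hx fun hh => hj hh.1.symm
  · simp

theorem trace_of_mem_of_ne {i j : ι} (hij : i ≠ j) {x : A} (hx : x ∈ P i j) :
    (∑ k, t k) x = 0 := by
  rw [LinearMap.sum_apply]
  exact Finset.sum_eq_zero fun k _ => T.eq_zero k i j x hx fun hh => hij (hh.1.trans hh.2.symm)

theorem trace_mul_eq_zero {i j k l : ι} (hne : ¬ (j = k ∧ l = i)) {x y : A} (hx : x ∈ P i j)
    (hy : y ∈ P k l) : (∑ m, t m) (x * y) = 0 := by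
  by_cases hjk : j = k
  · subst hjk
    exact trace_of_mem_of_ne h h2 H T (fun hil => hne ⟨rfl, hil.symm⟩) (mul_mem h h2 H hx hy)
  · by_cases hh : i = k ∧ j = l
    · obtain ⟨rfl, rfl⟩ := hh
      exact trace_of_mem_of_ne h h2 H T hjk (mul_mem_swap h h2 H (Ne.symm hjk) hx hy)
    · rw [mul_eq_zero h h2 H hjk hh hx hy, map_zero]

theorem trace_mul_comm (x y : A) : (∑ m, t m) (x * y) = (∑ m, t m) (y * x) := by
  refine induction_on h h2 H (p := fun x => (∑ m, t m) (x * y) = (∑ m, t m) (y * x)) x ?_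
    (fun a b ha hb => ?_) fun i j x hx => ?_
  · rw [zero_mul, mul_zero]
  · rw [add_mul, mul_add, map_add, map_add, ha, hb]
  refine induction_on h h2 H (p := fun y => (∑ m, t m) (x * y) = (∑ m, t m) (y * x)) y ?_
    (fun a b ha hb => ?_) fun k l y hy => ?_
  · rw [zero_mul, mul_zero]
  · rw [add_mul, mul_add, map_add, map_add, ha, hb]
  by_cases hne : j = k ∧ l = i
  · obtain ⟨rfl, rfl⟩ := hne
    rw [trace_of_mem_diag h h2 H T (mul_mem h h2 H hx hy),
      trace_of_mem_diag h h2 H T (mul_mem h h2 H hy hx), mul_swap h h2 H T hx hy]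
  · rw [trace_mul_eq_zero h h2 H T hne hx hy,
      trace_mul_eq_zero h h2 H T (fun hh => hne ⟨hh.2, hh.1⟩) hy hx]

theorem trace_mul_assoc (h3 : (3 : F) ≠ 0) (x y z : A) :
    (∑ m, t m) (x * y * z) = (∑ m, t m) (x * (y * z)) := by
  have c1 := congrArg (fun u => (∑ m, t m) u) (h.cyclic x y z)
  have c2 := congrArg (fun u => (∑ m, t m) u) (h.cyclic y z x)
  have s1 := trace_mul_comm h h2 H T x (y * z)
  have s2 := trace_mul_comm h h2 H T y (z * x)
  have s3 := trace_mul_comm h h2 H T z (x * y)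
  simp only [map_sub] at c1 c2
  have : (3 : F) * ((∑ m, t m) (x * y * z) - (∑ m, t m) (x * (y * z))) = 0 := by
    linear_combination 2 * c1 + c2 - s1 - s2 - s3
  exact sub_eq_zero.1 ((mul_eq_zero_iff_left h3).1 this)

end IsPeirceCharacter

/-- The radical of the bilinear form `(x, y) ↦ τ (x * y)`. -/
def traceRadical (τ : A →ₗ[F] F) : Submodule F A where
  carrier := {x | ∀ y, τ (x * y) = 0}
  add_mem' := fun hx hy z => by rw [add_mul, map_add, hx z, hy z, add_zero]
  zero_mem' := fun z => by rw [zero_mul, map_zero]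
  smul_mem' := fun c x hx z => by rw [smul_mul_assoc, map_smul, hx z, smul_zero]

namespace IsPeirceCharacter

open IsPeirceSystem

variable {t : ι → A →ₗ[F] F} (h : IsAlternative A) (h2 : (2 : F) ≠ 0) (H : IsPeirceSystem e)
  (T : IsPeirceCharacter e t)
include h h2 H T

theorem isTwoSidedIdeal_traceRadical (h3 : (3 : F) ≠ 0) :
    IsTwoSidedIdeal (traceRadical (∑ m, t m)) := by
  intro x hx u
  refine ⟨fun y => ?_, fun y => ?_⟩
  · rw [trace_mul_assoc h h2 H T h3, trace_mul_comm h h2 H T, trace_mul_assoc h h2 H T h3]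
    exact hx _
  · rw [trace_mul_assoc h h2 H T h3]
    exact hx _

theorem mem_traceRadical_iff {i j : ι} {x : A} (hx : x ∈ P i j) :
    x ∈ traceRadical (∑ m, t m) ↔ ∀ y ∈ P j i, t i (x * y) = 0 := by
  constructor
  · intro hxK y hy
    rw [← trace_of_mem_diag h h2 H T (mul_mem h h2 H hx hy)]
    exact hxK y
  · intro hxy y
    refine induction_on h h2 H (p := fun y => (∑ m, t m) (x * y) = 0) y ?_
      (fun a b ha hb => ?_) fun k l y hy => ?_
    · rw [mul_zero, map_zero]
    · rw [mul_add, map_add, ha, hb, add_zero]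
    by_cases hne : j = k ∧ l = i
    · obtain ⟨rfl, rfl⟩ := hne
      rw [trace_of_mem_diag h h2 H T (mul_mem h h2 H hx hy)]
      exact hxy y hy
    · exact trace_mul_eq_zero h h2 H T hne hx hy

theorem mem_traceRadical_iff_of_diag {i : ι} {x : A} (hx : x ∈ P i i) :
    x ∈ traceRadical (∑ m, t m) ↔ t i x = 0 := by
  rw [mem_traceRadical_iff h h2 H T hx]
  constructor
  · intro h0
    have := h0 _ (H.unit_mem i)
    rwa [hx.2] at this
  · intro h0 y hy
    rw [T.mul i x hx y hy, h0, zero_mul]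

end IsPeirceCharacter

end Trace

section Ideals

set_option linter.unusedSectionVars false

/-- The iterated products `K * (K * (⋯ * (K * A)))`. -/
def iteratedLeftMul {F A : Type*} [Field F] [NonUnitalNonAssocRing A] [Module F A]
    [SMulCommClass F A A] [IsScalarTower F A A] (K : Submodule F A) : ℕ → Submodule F A
  | 0 => ⊤
  | m + 1 => Submodule.map₂ (LinearMap.mul F A) K (iteratedLeftMul K m)

variable {F A ι : Type*} [Field F] [NonAssocRing A] [Module F A]
  [SMulCommClass F A A] [IsScalarTower F A A] [Fintype ι] {e : ι → A}

local notation "P" => peirceSpace F e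

namespace IsPeirceCharacter

open IsPeirceSystem

variable {t : ι → A →ₗ[F] F} (h : IsAlternative A) (h2 : (2 : F) ≠ 0) (H : IsPeirceSystem e)
  (T : IsPeirceCharacter e t)
include h h2 H T

theorem exists_ideal_complement (h3 : (3 : F) ≠ 0) [FiniteDimensional F A] {I : Submodule F A}
    (hI : IsTwoSidedIdeal I) (hKI : traceRadical (∑ m, t m) ≤ I) :
    ∃ I' : Submodule F A, IsTwoSidedIdeal I' ∧ I ⊔ I' = ⊤ ∧
      I ⊓ I' = traceRadical (∑ m, t m) := by
  set τ := ∑ m, t m with hτ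
  have hcomm := trace_mul_comm h h2 H T
  have hassoc := trace_mul_assoc h h2 H T h3
  rw [← hτ] at hcomm hassoc
  let B : LinearMap.BilinForm F A := (LinearMap.mul F A).compr₂ τ
  have hB : ∀ x y, B x y = τ (x * y) := fun x y => rfl
  have hker : LinearMap.ker B = traceRadical τ := by
    ext x
    exact ⟨fun hx y => LinearMap.congr_fun hx y, fun hx => LinearMap.ext hx⟩
  have hI' : IsTwoSidedIdeal (B.orthogonal I) := by
    intro y hy u
    constructor
    · intro x hx
      change τ (x * (u * y)) = 0
      rw [← hassoc]
      exact hy _ (hI x hx u).2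
    · intro x hx
      change τ (x * (y * u)) = 0
      rw [← hassoc, hcomm, ← hassoc]
      exact hy _ (hI x hx u).1
  have hle : traceRadical τ ≤ B.orthogonal I := by
    intro y hy x _
    change τ (x * y) = 0
    rw [hcomm]; exact hy x
  have hinf : I ⊓ B.orthogonal I ≤ traceRadical τ := by
    have hzero : ∀ x ∈ I ⊓ B.orthogonal I, τ x = 0 := by
      intro x hx
      have hmem : ∀ i, e i * (x * e i) ∈ I ⊓ B.orthogonal I := fun i =>
        ⟨(hI _ (hI _ hx.1 _).2 _).1, (hI' _ (hI' _ hx.2 _).2 _).1⟩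
      rw [← sum_component h h2 H x, map_sum]
      refine Finset.sum_eq_zero fun i _ => ?_
      rw [map_sum]
      refine Finset.sum_eq_zero fun j _ => ?_
      have hc := component_mem h h2 H (F := F) i j x
      by_cases hij : i = j
      · subst hij
        have h5 : τ (e i * (x * e i) * (e i * (x * e i))) = 0 := (hmem i).2 _ (hmem i).1
        rw [hτ, trace_of_mem_diag h h2 H T (mul_mem h h2 H hc hc), T.mul i _ hc _ hc] at h5
        rw [hτ, trace_of_mem_diag h h2 H T hc]
        exact mul_self_eq_zero.1 h5
      · exact trace_of_mem_of_ne h h2 H T hij hc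
    intro x hx y
    exact hzero _ ⟨(hI _ hx.1 _).2, (hI' _ hx.2 _).2⟩
  have hinf' : I ⊓ B.orthogonal I = traceRadical τ := le_antisymm hinf (le_inf hKI hle)
  refine ⟨B.orthogonal I, hI', ?_, hinf'⟩
  have h5 := LinearMap.BilinForm.finrank_add_finrank_orthogonal' (B := B) I
  rw [hker, inf_eq_right.2 hKI, ← Submodule.finrank_sup_add_finrank_inf_eq, hinf'] at h5
  exact Submodule.eq_top_of_finrank_eq (by omega)

theorem isNilpotent_span_mulLeft_traceRadical (h3 : (3 : F) ≠ 0) [FiniteDimensional F A] :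
    IsNilpotent ((traceRadical (∑ m, t m)).map (LinearMap.mul F A) :
      Submodule F (Module.End F A)) := by
  classical
  set K := traceRadical (∑ m, t m) with hK
  have hKI : IsTwoSidedIdeal K := isTwoSidedIdeal_traceRadical h h2 H T h3
  let G₁ : Set A := {x | ∃ i j, i ≠ j ∧ x ∈ P i j ∧ x ∈ K}
  let G₂ : Set A := {d | ∃ c : ι → A, (∀ i, c i ∈ P i i ∧ c i ∈ K) ∧ d = ∑ i, c i}
  have hzero : (0 : A) ∈ G₂ := ⟨0, fun i => ⟨zero_mem _, zero_mem _⟩, by simp⟩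
  have hsingle : ∀ i, ∀ x ∈ P i i, x ∈ K → x ∈ G₂ := by
    intro i x hx hxK
    refine ⟨Pi.single i x, fun j => ?_, by rw [Finset.sum_pi_single']; simp⟩
    by_cases hij : j = i
    · subst hij; rw [Pi.single_eq_same]; exact ⟨hx, hxK⟩
    · rw [Pi.single_eq_of_ne hij]; exact ⟨zero_mem _, zero_mem _⟩
  have hadd : ∀ x ∈ G₂, ∀ y ∈ G₂, x + y ∈ G₂ := by
    rintro _ ⟨c, hc, rfl⟩ _ ⟨d, hd, rfl⟩
    exact ⟨c + d, fun i => ⟨add_mem (hc i).1 (hd i).1, add_mem (hc i).2 (hd i).2⟩,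
      by simp [Finset.sum_add_distrib]⟩
  have hmul₁ : ∀ i j k l, i ≠ j → k ≠ l → ∀ x ∈ P i j, x ∈ K → ∀ y ∈ P k l,
      x * y + y * x ∈ G₁ ∪ G₂ := by
    intro i j k l hij hkl x hx hxK y hy
    have hxy := (hKI x hxK y).2
    have hyx := (hKI x hxK y).1
    by_cases hjk : j = k
    · subst hjk
      by_cases hil : l = i
      · subst hil
        exact Or.inr (hadd _ (hsingle _ _ (mul_mem h h2 H hx hy) hxy) _
          (hsingle _ _ (mul_mem h h2 H hy hx) hyx))
      · rw [mul_eq_zero h h2 H hil (by rintro ⟨rfl, rfl⟩; exact hil rfl) hy hx, add_zero]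
        exact Or.inl ⟨i, l, Ne.symm hil, mul_mem h h2 H hx hy, hxy⟩
    · by_cases hil : l = i
      · subst hil
        rw [mul_eq_zero h h2 H hjk (by rintro ⟨rfl, rfl⟩; exact hjk rfl) hx hy, zero_add]
        exact Or.inl ⟨k, j, Ne.symm hjk, mul_mem h h2 H hy hx, hyx⟩
      · refine Or.inr ?_
        by_cases hh : i = k ∧ j = l
        · obtain ⟨rfl, rfl⟩ := hh
          rw [mul_anticomm h h2 H hij hx hy, add_neg_cancel]
          exact hzero
        · rw [mul_eq_zero h h2 H hjk hh hx hy,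
            mul_eq_zero h h2 H hil (fun h5 => hh ⟨h5.1.symm, h5.2.symm⟩) hy hx, add_zero]
          exact hzero
  have hdiag : ∀ (c : ι → A), (∀ i, c i ∈ P i i) → ∀ i j, ∀ x ∈ P i j,
      (∑ k, c k) * x = c i * x ∧ x * ∑ k, c k = x * c j := by
    intro c hc i j x hx
    constructor
    · rw [Finset.sum_mul, Finset.sum_eq_single i]
      · intro k _ hk
        exact mul_eq_zero h h2 H hk (fun h5 => hk h5.1) (hc k) hx
      · simp
    · rw [Finset.mul_sum, Finset.sum_eq_single j]
      · intro k _ hk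
        exact mul_eq_zero h h2 H (Ne.symm hk) (fun h5 => hk h5.2.symm) hx (hc k)
      · simp
  have hmul₂ : ∀ i j, i ≠ j → ∀ x ∈ P i j, x ∈ K → ∀ d ∈ G₂, x * d + d * x ∈ G₁ ∪ G₂ := by
    rintro i j hij x hx hxK _ ⟨c, hc, rfl⟩
    rw [(hdiag c (fun i => (hc i).1) i j x hx).1, (hdiag c (fun i => (hc i).1) i j x hx).2]
    exact Or.inl ⟨i, j, hij, add_mem (mul_mem h h2 H hx (hc j).1) (mul_mem h h2 H (hc i).1 hx),
      add_mem (hKI x hxK _).2 (hKI x hxK _).1⟩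
  have hmul₃ : ∀ x ∈ G₂, ∀ y ∈ G₂, x * y ∈ G₂ := by
    rintro _ ⟨c, hc, rfl⟩ _ ⟨d, hd, rfl⟩
    refine ⟨fun i => c i * d i, fun i => ⟨mul_mem h h2 H (hc i).1 (hd i).1, (hKI _ (hc i).2 _).2⟩,
      ?_⟩
    rw [Finset.mul_sum]
    exact Finset.sum_congr rfl fun i _ => (hdiag c (fun i => (hc i).1) i i _ (hd i).1).1
  have hmul : ∀ x ∈ G₁ ∪ G₂, ∀ y ∈ G₁ ∪ G₂, x * y + y * x ∈ G₁ ∪ G₂ := by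
    rintro x (⟨i, j, hij, hx, hxK⟩ | hx) y (⟨k, l, hkl, hy, hyK⟩ | hy)
    · exact hmul₁ i j k l hij hkl x hx hxK y hy
    · exact hmul₂ i j hij x hx hxK y hy
    · rw [add_comm]; exact hmul₂ k l hkl y hy hyK x hx
    · exact Or.inr (hadd _ (hmul₃ x hx y hy) _ (hmul₃ y hy x hx))
  have hnil : ∀ x ∈ G₁ ∪ G₂, IsNilpotent (LinearMap.mul F A x : Module.End F A) := by
    rintro x (⟨i, j, hij, hx, hxK⟩ | ⟨c, hc, rfl⟩)
    · refine ⟨2, LinearMap.ext fun z => ?_⟩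
      rw [pow_two, Module.End.mul_apply]
      change x * (x * z) = 0
      rw [← (h x z).1, mul_self_eq_zero h h2 H hij hx, zero_mul]
    · rw [map_sum]
      have hprod : ∀ i j, i ≠ j →
          (LinearMap.mul F A (c i) * LinearMap.mul F A (c j) : Module.End F A) = 0 := by
        intro i j hij
        refine LinearMap.ext fun z => ?_
        change c i * (c j * z) = 0
        refine induction_on h h2 H (p := fun z => c i * (c j * z) = 0) z ?_
          (fun a b ha hb => ?_) fun k l y hy => ?_
        · rw [mul_zero, mul_zero]
        · rw [mul_add, mul_add, ha, hb, add_zero]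
        · by_cases hjk : j = k
          · subst hjk
            exact mul_eq_zero h h2 H hij (fun h5 => hij h5.1) (hc i).1
              (mul_mem h h2 H (hc j).1 hy)
          · rw [mul_eq_zero h h2 H hjk (fun h5 => hjk h5.1) (hc j).1 hy, mul_zero]
      refine Commute.isNilpotent_sum (fun i _ => ?_) fun i j _ _ => ?_
      · obtain ⟨m, hm⟩ := T.nilpotent i (c i) (hc i).1
          ((mem_traceRadical_iff_of_diag h h2 H T (hc i).1).1 (hc i).2)
        exact IsAlternative.isNilpotent_mulLeft h h2 hm
      · by_cases hij : i = j
        · subst hij; exact Commute.refl _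
        · rw [Commute, SemiconjBy, hprod i j hij, hprod j i (Ne.symm hij)]
  have hmain := Submodule.isNilpotent_span_of_jordan_closed (F := F)
    (T := (fun x => (LinearMap.mul F A x : Module.End F A)) '' (G₁ ∪ G₂))
    (by rintro _ ⟨x, hx, rfl⟩; exact hnil x hx)
    (by
      rintro _ ⟨x, hx, rfl⟩ _ ⟨y, hy, rfl⟩
      refine ⟨_, hmul x hx y hy, LinearMap.ext fun z => ?_⟩
      have := h.left_linearized x y z
      change (x * y + y * x) * z = x * (y * z) + y * (x * z)
      rw [add_mul, this])
  obtain ⟨n, hn⟩ := hmain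
  refine ⟨n, ?_⟩
  rw [Submodule.zero_eq_bot, eq_bot_iff] at hn ⊢
  refine le_trans (pow_le_pow_left' ?_ n) hn
  rw [Submodule.map_le_iff_le_comap]
  intro x hx
  rw [← sum_component h h2 H x]
  refine Submodule.sum_mem _ fun i _ => Submodule.sum_mem _ fun j _ => ?_
  refine Submodule.subset_span ⟨_, ?_, rfl⟩
  have hc := component_mem h h2 H (F := F) i j x
  have hcK : e i * (x * e j) ∈ K := (hKI _ (hKI _ hx _).2 _).1
  by_cases hij : i = j
  · subst hij; exact Or.inr (hsingle i _ hc hcK)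
  · exact Or.inl ⟨i, j, hij, hc, hcK⟩

theorem exists_iteratedLeftMul_traceRadical_eq_bot (h3 : (3 : F) ≠ 0) [FiniteDimensional F A] :
    ∃ n, iteratedLeftMul (traceRadical (∑ m, t m)) n = ⊥ := by
  obtain ⟨n, hn⟩ := isNilpotent_span_mulLeft_traceRadical h h2 H T h3
  set K := traceRadical (∑ m, t m) with hK
  set N : Submodule F (Module.End F A) := K.map (LinearMap.mul F A) with hN
  have hle : ∀ m, iteratedLeftMul K m ≤ Submodule.map₂ LinearMap.id (N ^ m) ⊤ := by
    intro m
    induction m with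
    | zero =>
      intro x _
      exact Submodule.apply_mem_map₂ (LinearMap.id : Module.End F A →ₗ[F] Module.End F A)
        (m := 1) (n := x) (by rw [pow_zero]; exact Submodule.one_le.1 le_rfl) trivial
    | succ m ih =>
      change Submodule.map₂ (LinearMap.mul F A) K (iteratedLeftMul K m) ≤ _
      rw [Submodule.map₂_le]
      intro x hx z hz
      have hz' := ih hz
      clear hz
      rw [Submodule.map₂_eq_span_image2] at hz'
      induction hz' using Submodule.span_induction with
      | mem z hz =>
        obtain ⟨f, hf, w, -, rfl⟩ := hz
        refine Submodule.apply_mem_map₂ (LinearMap.id : Module.End F A →ₗ[F] Module.End F A)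
          (m := LinearMap.mul F A x * f) (n := w) ?_ trivial
        rw [pow_succ']
        exact Submodule.mul_mem_mul (Submodule.mem_map_of_mem hx) hf
      | zero => rw [map_zero]; exact zero_mem _
      | add a b _ _ ha hb => rw [map_add]; exact add_mem ha hb
      | smul c a _ ha => rw [map_smul]; exact Submodule.smul_mem _ c ha
  refine ⟨n, eq_bot_iff.2 ((hle n).trans ?_)⟩
  rw [hn, Submodule.zero_eq_bot, Submodule.map₂_bot_left]

end IsPeirceCharacter

end Ideals

section Cayley

set_option linter.unusedSectionVars false

variable {F A ι : Type*} [Field F] [NonAssocRing A] [Module F A]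
  [SMulCommClass F A A] [IsScalarTower F A A] [Fintype ι] {e : ι → A}

local notation "P" => peirceSpace F e

/-- Two families of three elements in opposite off-diagonal Peirce spaces which multiply like
the off-diagonal basis vectors of a split Cayley algebra. -/
structure IsCayleyFrame (F : Type*) {A ι : Type*} [Field F] [NonAssocRing A] [Module F A]
    [SMulCommClass F A A] [IsScalarTower F A A] (e : ι → A) (i j : ι) (u v : Fin 3 → A) :
    Prop where
  left_mem : ∀ k, u k ∈ peirceSpace F e i j
  right_mem : ∀ k, v k ∈ peirceSpace F e j i
  left_mul_right : ∀ k l, u k * v l = if k = l then e i else 0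
  right_mul_left : ∀ k l, v k * u l = if k = l then e j else 0
  left_mul_left : ∀ k, u k * u (k + 1) = v (k + 2)
  right_mul_right : ∀ k, v k * v (k + 1) = -u (k + 2)

theorem Fin.three_eq_or_eq_add (k l : Fin 3) : l = k ∨ l = k + 1 ∨ l = k + 2 := by
  revert k l; decide

theorem Fin.three_add_cycle (k : Fin 3) :
    k + 1 + 1 = k + 2 ∧ k + 1 + 2 = k ∧ k + 2 + 1 = k ∧ k + 2 + 2 = k + 1 := by
  revert k; decide

theorem Fin.three_ne_add (k : Fin 3) : k ≠ k + 1 ∧ k ≠ k + 2 ∧ k + 1 ≠ k + 2 := by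
  revert k; decide

open IsPeirceSystem

theorem IsCayleyFrame.symm {i j : ι} {u v : Fin 3 → A} (C : IsCayleyFrame F e i j u v) :
    IsCayleyFrame F e j i (fun k => -v k) (fun k => -u k) where
  left_mem k := (P j i).neg_mem (C.right_mem k)
  right_mem k := (P i j).neg_mem (C.left_mem k)
  left_mul_right k l := by rw [neg_mul_neg, C.right_mul_left]
  right_mul_left k l := by rw [neg_mul_neg, C.left_mul_right]
  left_mul_left k := by rw [neg_mul_neg, C.right_mul_right]
  right_mul_right k := by rw [neg_mul_neg, C.left_mul_left, neg_neg]

theorem IsPeirceSystem.exists_isCayleyFrame (h : IsAlternative A) (h2 : (2 : F) ≠ 0)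
    (H : IsPeirceSystem e) {i j : ι} (hij : i ≠ j) {x y z : A} (hx : x ∈ P i j) (hy : y ∈ P i j)
    (hz : z ∈ P i j) (hxyz : x * (y * z) = e i) : ∃ u v, IsCayleyFrame F e i j u v := by
  let u : Fin 3 → A := ![x, y, z]
  let v : Fin 3 → A := fun k => u (k + 1) * u (k + 2)
  have hv : ∀ k, v k = u (k + 1) * u (k + 2) := fun k => rfl
  have hu : ∀ k, u k ∈ P i j := by
    intro k; fin_cases k; exacts [hx, hy, hz]
  have hvm : ∀ k, v k ∈ P j i := fun k => mul_mem_swap h h2 H hij (hu _) (hu _)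
  have huv : ∀ k, u k * v k = e i := by
    have c1 := (mul_mul_cyclic h h2 H hij hx hy hz).2
    have c2 := (mul_mul_cyclic h h2 H hij hy hz hx).2
    intro k
    fin_cases k
    · exact hxyz
    · exact c1.symm.trans hxyz
    · exact (c1.trans c2).symm.trans hxyz
  have hvu : ∀ k, v k * u k = e j := by
    intro k
    have e1 : u k * (v k * u k) = u k := by rw [← h.flexible, huv, (hu k).1]
    have hm := mul_mem h h2 H (hvm k) (hu k)
    have e2 : v k * u k * (v k * u k) = v k * u k := by
      rw [mul_assoc_of_mem h h2 H (fun hh => hij hh.2.symm) (hvm k) (hu k) hm, e1]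
    refine (H.primitive j _ e2 hm.1 hm.2).resolve_left fun h0 => H.ne_zero i ?_
    rw [h0, mul_zero] at e1
    rw [← huv k, ← e1, zero_mul]
  have flex : ∀ k l, u k * (u l * u k) = 0 ∧ u k * u l * u k = 0 := by
    intro k l
    have m1 := mul_mem h h2 H (hu k) (mul_mem_swap h h2 H hij (hu l) (hu k))
    have m2 := mul_mem h h2 H (mul_mem_swap h h2 H hij (hu k) (hu l)) (hu k)
    rw [h.flexible] at m2
    have := eq_zero_of_mem_of_ne h h2 H m1 m2 (Or.inl hij)
    exact ⟨this, by rw [h.flexible, this]⟩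
  have huu := fun k => mul_self_eq_zero h h2 H hij (hu k)
  have huv1 : ∀ k, u k * v (k + 1) = 0 := by
    intro k
    rw [hv, (Fin.three_add_cycle k).2.1]
    exact (flex _ _).1
  have huv2 : ∀ k, u k * v (k + 2) = 0 := by
    intro k
    rw [hv, (Fin.three_add_cycle k).2.2.1, ← (h _ _).1, huu, zero_mul]
  have hvu1 : ∀ k, v (k + 1) * u k = 0 := by
    intro k
    rw [hv, (Fin.three_add_cycle k).2.1, (h _ _).2, huu, mul_zero]
  have hvu2 : ∀ k, v (k + 2) * u k = 0 := by
    intro k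
    rw [hv, (Fin.three_add_cycle k).2.2.1]
    exact (flex _ _).2
  refine ⟨u, v, hu, hvm, ?_, ?_, ?_, ?_⟩
  · intro k l
    rcases Fin.three_eq_or_eq_add k l with rfl | rfl | rfl
    · rw [if_pos rfl, huv]
    · rw [if_neg (Fin.three_ne_add k).1, huv1]
    · rw [if_neg (Fin.three_ne_add k).2.1, huv2]
  · intro k l
    rcases Fin.three_eq_or_eq_add l k with rfl | rfl | rfl
    · rw [if_pos rfl, hvu]
    · rw [if_neg (Fin.three_ne_add l).1.symm, hvu1]
    · rw [if_neg (Fin.three_ne_add l).2.1.symm, hvu2]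
  · intro k
    rw [hv, (Fin.three_add_cycle k).2.2.1, (Fin.three_add_cycle k).2.2.2]
  · intro k
    have hv' : v (k + 1) = u (k + 2) * u k := by
      rw [hv, (Fin.three_add_cycle k).2.1, (Fin.three_add_cycle k).1]
    have e1 := h.left_linearized (v k) (u (k + 2)) (u k)
    have e3 : v k * u (k + 2) = 0 := by
      have := hvu1 (k + 2)
      rwa [(Fin.three_add_cycle k).2.2.1] at this
    have e4 : u (k + 2) * v k = 0 := by
      have := huv1 (k + 2)
      rwa [(Fin.three_add_cycle k).2.2.1] at this
    rw [e3, e4, hvu, (hu _).2, ← hv'] at e1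
    rw [eq_neg_iff_add_eq_zero, ← e1]
    simp

namespace IsPeirceCharacter

variable {t : ι → A →ₗ[F] F} (h : IsAlternative A) (h2 : (2 : F) ≠ 0) (H : IsPeirceSystem e)
  (T : IsPeirceCharacter e t) (h3 : (3 : F) ≠ 0)
include h h2 H T

theorem sub_smul_unit_mem {i : ι} {x : A} (hx : x ∈ P i i) :
    x - t i x • e i ∈ traceRadical (∑ m, t m) := by
  rw [mem_traceRadical_iff_of_diag h h2 H T
    ((P i i).sub_mem hx ((P i i).smul_mem _ (H.unit_mem i))), map_sub, map_smul, T.unit]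
  simp

theorem mul_mem_traceRadical_swap {i j : ι} {x y : A} (hx : x ∈ P i j) (hy : y ∈ P j i)
    (hxy : x * y ∈ traceRadical (∑ m, t m)) : y * x ∈ traceRadical (∑ m, t m) := by
  rw [mem_traceRadical_iff_of_diag h h2 H T (mul_mem h h2 H hx hy)] at hxy
  rwa [mem_traceRadical_iff_of_diag h h2 H T (mul_mem h h2 H hy hx), ← mul_swap h h2 H T hx hy]

include h3

theorem mem_traceRadical_of_isCayleyFrame {i j : ι} (hij : i ≠ j) {u v : Fin 3 → A}
    (C : IsCayleyFrame F e i j u v) {x : A} (hx : x ∈ P i j)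
    (hxv : ∀ k, x * v k ∈ traceRadical (∑ m, t m)) : x ∈ traceRadical (∑ m, t m) := by
  have hI := isTwoSidedIdeal_traceRadical h h2 H T h3
  set K := traceRadical (∑ m, t m)
  have hvx : ∀ k, v k * x ∈ K := fun k =>
    mul_mem_traceRadical_swap h h2 H T hx (C.right_mem k) (hxv k)
  have hu := C.left_mem
  have e01 : u 0 * u 1 = v 2 := C.left_mul_left 0
  have e12 : u 1 * u 2 = v 0 := C.left_mul_left 1
  have e20 : u 2 * u 0 = v 1 := C.left_mul_left 2
  have e02 : u 0 * u 2 = -v 1 := by rw [mul_anticomm h h2 H hij (hu 2) (hu 0), e20]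
  have w1 : x * u 0 * u 1 ∈ K := by
    rw [(mul_mul_cyclic h h2 H hij hx (hu 0) (hu 1)).1, e01]; exact hvx 2
  have w2 : x * u 0 * u 2 ∈ K := by
    rw [(mul_mul_cyclic h h2 H hij hx (hu 0) (hu 2)).1, e02, neg_mul]; exact K.neg_mem (hvx 1)
  have w3 : u 1 * (x * u 0) ∈ K := by
    rw [(mul_mul_cyclic h h2 H hij (hu 1) hx (hu 0)).2, e01]; exact hxv 2
  have e1 := h.left_linearized (x * u 0) (u 1) (u 2)
  rw [e12] at e1
  have m1 : x * u 0 * v 0 ∈ K := by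
    have : x * u 0 * v 0 = (x * u 0 * u 1 + u 1 * (x * u 0)) * u 2 - u 1 * (x * u 0 * u 2) := by
      rw [add_mul, e1]; abel
    rw [this]
    exact K.sub_mem (hI _ (K.add_mem w1 w3) _).2 (hI _ w2 _).1
  have e2 := h.cyclic x (u 0) (v 0)
  rw [C.left_mul_right, if_pos rfl, mul_unit h h2 H hx hij, hx.1, sub_zero] at e2
  have : x = x * u 0 * v 0 + u 0 * (v 0 * x) := by rw [e2]; abel
  rw [this]
  exact K.add_mem m1 (hI _ (hvx 0) _).1

theorem le_span_sup_of_isCayleyFrame {i j : ι} (hij : i ≠ j) {u v : Fin 3 → A}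
    (C : IsCayleyFrame F e i j u v) :
    P i j ≤ Submodule.span F (Set.range u) ⊔ traceRadical (∑ m, t m) := by
  intro x hx
  have hs : ∑ k, t i (x * v k) • u k ∈ P i j :=
    Submodule.sum_mem _ fun k _ => Submodule.smul_mem _ _ (C.left_mem k)
  have hK : x - ∑ k, t i (x * v k) • u k ∈ traceRadical (∑ m, t m) := by
    refine mem_traceRadical_of_isCayleyFrame h h2 H T h3 hij C ((P i j).sub_mem hx hs) fun l => ?_
    have : (x - ∑ k, t i (x * v k) • u k) * v l = x * v l - t i (x * v l) • e i := by
      rw [sub_mul, Finset.sum_mul]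
      simp [smul_mul_assoc, C.left_mul_right]
    rw [this]
    exact sub_smul_unit_mem h h2 H T (mul_mem h h2 H hx (C.right_mem l))
  refine Submodule.mem_sup.2 ⟨_, Submodule.sum_mem _ fun k _ => Submodule.smul_mem _ _
    (Submodule.subset_span ⟨k, rfl⟩), _, hK, add_sub_cancel _ _⟩

theorem span_inf_eq_bot_of_isCayleyFrame {i j : ι} {u v : Fin 3 → A}
    (C : IsCayleyFrame F e i j u v) :
    Submodule.span F (Set.range u) ⊓ traceRadical (∑ m, t m) = ⊥ := by
  rw [eq_bot_iff]
  rintro x ⟨hx, hK⟩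
  obtain ⟨c, rfl⟩ := (Submodule.mem_span_range_iff_exists_fun F).1 hx
  refine Finset.sum_eq_zero fun l _ => ?_
  have h1 := ((isTwoSidedIdeal_traceRadical h h2 H T h3) _ hK (v l)).2
  have : (∑ k, c k • u k) * v l = c l • e i := by
    rw [Finset.sum_mul]; simp [smul_mul_assoc, C.left_mul_right]
  rw [this, mem_traceRadical_iff_of_diag h h2 H T ((P i i).smul_mem _ (H.unit_mem i)),
    map_smul, T.unit, smul_eq_mul, mul_one] at h1
  rw [h1, zero_smul]

end IsPeirceCharacter

theorem IsCayleyFrame.mul_mem_span {i j : ι} (h : IsAlternative A) (h2 : (2 : F) ≠ 0)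
    (H : IsPeirceSystem e) (hij : i ≠ j) {u v : Fin 3 → A}
    (C : IsCayleyFrame F e i j u v) {x y : A} (hx : x ∈ Submodule.span F (Set.range u))
    (hy : y ∈ Submodule.span F (Set.range u)) : x * y ∈ Submodule.span F (Set.range v) := by
  obtain ⟨c, rfl⟩ := (Submodule.mem_span_range_iff_exists_fun F).1 hx
  obtain ⟨d, rfl⟩ := (Submodule.mem_span_range_iff_exists_fun F).1 hy
  have hv : ∀ k, v k ∈ Submodule.span F (Set.range v) := fun k => Submodule.subset_span ⟨k, rfl⟩
  rw [Finset.sum_mul_sum]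
  refine Submodule.sum_mem _ fun k _ => Submodule.sum_mem _ fun l _ => ?_
  rw [smul_mul_assoc, mul_smul_comm]
  refine Submodule.smul_mem _ _ (Submodule.smul_mem _ _ ?_)
  rcases Fin.three_eq_or_eq_add k l with rfl | rfl | rfl
  · rw [mul_self_eq_zero h h2 H hij (C.left_mem _)]; exact zero_mem _
  · rw [C.left_mul_left]; exact hv _
  · have := C.left_mul_left (k + 2)
    rw [(Fin.three_add_cycle k).2.2.1] at this
    rw [mul_anticomm h h2 H hij (C.left_mem (k + 2)) (C.left_mem k), this]
    exact neg_mem (hv _)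

theorem IsCayleyFrame.mul_mem_span_unit {i j : ι} {u v : Fin 3 → A}
    (C : IsCayleyFrame F e i j u v) {x y : A} (hx : x ∈ Submodule.span F (Set.range u))
    (hy : y ∈ Submodule.span F (Set.range v)) : x * y ∈ Submodule.span F {e i} := by
  obtain ⟨c, rfl⟩ := (Submodule.mem_span_range_iff_exists_fun F).1 hx
  obtain ⟨d, rfl⟩ := (Submodule.mem_span_range_iff_exists_fun F).1 hy
  rw [Finset.sum_mul_sum]
  refine Submodule.sum_mem _ fun k _ => Submodule.sum_mem _ fun l _ => ?_
  rw [smul_mul_assoc, mul_smul_comm, C.left_mul_right]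
  refine Submodule.smul_mem _ _ (Submodule.smul_mem _ _ ?_)
  split_ifs
  · exact Submodule.mem_span_singleton_self _
  · exact zero_mem _

end Cayley

section Classes

set_option linter.unusedSectionVars false

variable {F A ι : Type*} [Field F] [NonAssocRing A] [Module F A]
  [SMulCommClass F A A] [IsScalarTower F A A] [Fintype ι] {e : ι → A}

local notation "P" => peirceSpace F e

/-- Two indices of a Peirce system are linked if there are mutually inverse elements in the
corresponding off-diagonal Peirce spaces. -/
def PeirceLinked (F : Type*) {A ι : Type*} [Field F] [NonAssocRing A] [Module F A]
    [SMulCommClass F A A] [IsScalarTower F A A] (e : ι → A) (i j : ι) : Prop :=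
  ∃ x ∈ peirceSpace F e i j, ∃ y ∈ peirceSpace F e j i, x * y = e i ∧ y * x = e j

open IsPeirceSystem

/-- Matrix units for the indices satisfying `p`. -/
structure IsMatrixUnits (F : Type*) {A ι : Type*} [Field F] [NonAssocRing A] [Module F A]
    [SMulCommClass F A A] [IsScalarTower F A A] (e : ι → A) (p : ι → Prop) (E : ι → ι → A) :
    Prop where
  mem : ∀ i j, p i → p j → E i j ∈ peirceSpace F e i j
  unit : ∀ i, p i → E i i = e i
  mul : ∀ i j k, p i → p j → p k → E i j * E j k = E i k

/-- A family of subspaces of the Peirce spaces, indexed by indices satisfying `p`, which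
complements `K` and is closed under multiplication. -/
structure IsPeirceComplement {F A ι : Type*} [Field F] [NonAssocRing A] [Module F A]
    [SMulCommClass F A A] [IsScalarTower F A A] (e : ι → A) (K : Submodule F A) (p : ι → Prop)
    (S : ι → ι → Submodule F A) : Prop where
  le : ∀ i j, p i → p j → S i j ≤ peirceSpace F e i j
  le_sup : ∀ i j, p i → p j → peirceSpace F e i j ≤ S i j ⊔ K
  inf_eq_bot : ∀ i j, p i → p j → S i j ⊓ K = ⊥
  mul_mem : ∀ i j k, p i → p j → p k → ∀ x ∈ S i j, ∀ y ∈ S j k, x * y ∈ S i k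
  mul_mem_swap : ∀ i j, p i → p j → i ≠ j → ∀ x ∈ S i j, ∀ y ∈ S i j, x * y ∈ S j i

theorem PeirceLinked.refl (H : IsPeirceSystem e) (i : ι) : PeirceLinked F e i i :=
  ⟨e i, H.unit_mem i, e i, H.unit_mem i, H.mul_self i, H.mul_self i⟩

theorem PeirceLinked.symm {i j : ι} (hl : PeirceLinked F e i j) : PeirceLinked F e j i := by
  obtain ⟨x, hx, y, hy, h1, h3⟩ := hl
  exact ⟨y, hy, x, hx, h3, h1⟩

namespace IsPeirceSystem

variable (h : IsAlternative A) (h2 : (2 : F) ≠ 0) (H : IsPeirceSystem e)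
include h h2 H

theorem linked_trans {i j k : ι} (hij : PeirceLinked F e i j) (hjk : PeirceLinked F e j k) :
    PeirceLinked F e i k := by
  by_cases hik : i = k
  · subst hik; exact PeirceLinked.refl H i
  obtain ⟨x, hx, y, hy, h1, h3⟩ := hij
  obtain ⟨z, hz, w, hw, h5, h6⟩ := hjk
  refine ⟨x * z, mul_mem h h2 H hx hz, w * y, mul_mem h h2 H hw hy, ?_, ?_⟩
  · rw [mul_assoc_of_mem h h2 H (fun hh => hik hh.1.symm) hx hz (mul_mem h h2 H hw hy),
      ← mul_assoc_of_mem h h2 H (fun hh => hik hh.2) hz hw hy, h5, hy.1, h1]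
  · rw [mul_assoc_of_mem h h2 H (fun hh => hik hh.1) hw hy (mul_mem h h2 H hx hz),
      ← mul_assoc_of_mem h h2 H (fun hh => hik hh.2.symm) hy hx hz, h3, hz.1, h6]

theorem exists_isMatrixUnits (r : ι) : ∃ E, IsMatrixUnits F e (PeirceLinked F e r) E := by
  have : ∀ i, ∃ x y, PeirceLinked F e r i → x ∈ P r i ∧ y ∈ P i r ∧ x * y = e r ∧ y * x = e i := by
    intro i
    by_cases hi : PeirceLinked F e r i
    · obtain ⟨x, hx, y, hy, hh⟩ := hi
      exact ⟨x, y, fun _ => ⟨hx, hy, hh⟩⟩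
    · exact ⟨0, 0, fun hi' => absurd hi' hi⟩
  choose x y hxy using this
  refine ⟨fun i j => y i * x j, fun i j hi hj => mul_mem h h2 H (hxy i hi).2.1 (hxy j hj).1,
    fun i hi => (hxy i hi).2.2.2, fun i j k hi hj hk => ?_⟩
  obtain ⟨xi, yi, xyi, yxi⟩ := hxy i hi
  obtain ⟨xj, yj, xyj, yxj⟩ := hxy j hj
  obtain ⟨xk, yk, xyk, yxk⟩ := hxy k hk
  have hjk := mul_mem h h2 H yj xk
  change y i * x j * (y j * x k) = y i * x k
  by_cases hji : j = i
  · subst hji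
    rw [yxj, hjk.1]
  rw [mul_assoc_of_mem h h2 H (fun hh => hji hh.1) yi xj hjk]
  by_cases hkj : k = j
  · subst hkj
    rw [yxk, xk.2]
  · rw [← mul_assoc_of_mem h h2 H (fun hh => hkj hh.2) xj yj xk, xyj, xk.1]

end IsPeirceSystem

namespace IsPeirceCharacter

variable {t : ι → A →ₗ[F] F} (h : IsAlternative A) (h2 : (2 : F) ≠ 0) (H : IsPeirceSystem e)
  (T : IsPeirceCharacter e t)
include h h2 H T

theorem unit_notMem_traceRadical (i : ι) : e i ∉ traceRadical (∑ m, t m) := by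
  rw [mem_traceRadical_iff_of_diag h h2 H T (H.unit_mem i), T.unit]
  exact one_ne_zero

theorem diag_le_span_sup (i : ι) : P i i ≤ Submodule.span F {e i} ⊔ traceRadical (∑ m, t m) :=
  fun x hx => Submodule.mem_sup.2 ⟨_, Submodule.smul_mem _ (t i x)
    (Submodule.mem_span_singleton_self (e i)), _, sub_smul_unit_mem h h2 H T hx,
    add_sub_cancel _ _⟩

theorem span_unit_inf (i : ι) : Submodule.span F {e i} ⊓ traceRadical (∑ m, t m) = ⊥ := by
  rw [eq_bot_iff]
  rintro x ⟨hx, hK⟩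
  obtain ⟨c, rfl⟩ := Submodule.mem_span_singleton.1 hx
  by_cases hc : c = 0
  · rw [hc, zero_smul]; exact zero_mem _
  · have := (traceRadical (∑ m, t m)).smul_mem c⁻¹ hK
    rw [inv_smul_smul₀ hc] at this
    exact absurd this (unit_notMem_traceRadical h h2 H T i)

theorem le_traceRadical_of_not_linked {i j : ι} (hl : ¬ PeirceLinked F e i j) :
    P i j ≤ traceRadical (∑ m, t m) := by
  have hij : i ≠ j := by rintro rfl; exact hl (PeirceLinked.refl H i)
  intro x hx
  rw [mem_traceRadical_iff h h2 H T hx]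
  intro y hy
  by_contra hne
  obtain ⟨d, hd, hdc, -⟩ := T.inverse i _ (mul_mem h h2 H hx hy) hne
  have hdx := mul_mem h h2 H hd hx
  have e1 : d * x * y = e i := by
    rw [mul_assoc_of_mem h h2 H (fun hh => hij hh.1.symm) hd hx hy, hdc]
  have hm := mul_mem h h2 H hy hdx
  have e2 : d * x * (y * (d * x)) = d * x := by rw [← h.flexible, e1, hdx.1]
  have e3 : y * (d * x) * (y * (d * x)) = y * (d * x) := by
    rw [mul_assoc_of_mem h h2 H (fun hh => hij hh.2.symm) hy hdx hm, e2]
  refine hl ⟨_, hdx, y, hy, e1, (H.primitive j _ e3 hm.1 hm.2).resolve_left fun h0 => ?_⟩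
  rw [h0, mul_zero] at e2
  rw [← e2, zero_mul] at e1
  exact H.ne_zero i e1.symm

variable (h3 : (3 : F) ≠ 0)
include h3

theorem le_span_sup_of_third_index {p : ι → Prop} {E : ι → ι → A} (M : IsMatrixUnits F e p E)
    {i j k : ι} (hi : p i) (hj : p j) (hk : p k) (hki : k ≠ i) (hkj : k ≠ j) :
    P i j ≤ Submodule.span F {E i j} ⊔ traceRadical (∑ m, t m) := by
  intro x hx
  have hxk := mul_mem h h2 H hx (M.mem j k hj hk)
  have e1 : x * E j k * E k j = x := by
    rw [mul_assoc_of_mem h h2 H (fun hh => hki hh.1) hx (M.mem j k hj hk) (M.mem k j hk hj),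
      M.mul j k j hj hk hj, M.unit j hj, hx.2]
  have e2 : x * E j i = x * E j k * E k i := by
    rw [mul_assoc_of_mem h h2 H (fun hh => hki hh.1) hx (M.mem j k hj hk) (M.mem k i hk hi),
      M.mul j k i hj hk hi]
  have e3 : x * E j i * E i j = x := by
    rw [e2, mul_assoc_of_mem h h2 H (fun hh => hkj hh.2.symm) hxk (M.mem k i hk hi)
        (M.mem i j hi hj),
      M.mul k i j hk hi hj, e1]
  have hd := sub_smul_unit_mem h h2 H T (mul_mem h h2 H hx (M.mem j i hj hi))
  have hd' := ((isTwoSidedIdeal_traceRadical h h2 H T h3) _ hd (E i j)).2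
  rw [sub_mul, e3, smul_mul_assoc, (M.mem i j hi hj).1] at hd'
  exact Submodule.mem_sup.2 ⟨_, Submodule.smul_mem _ _ (Submodule.mem_span_singleton_self _), _,
    hd', add_sub_cancel _ _⟩

theorem isPeirceComplement_of_isMatrixUnits {p : ι → Prop} {E : ι → ι → A}
    (M : IsMatrixUnits F e p E) (hE : ∀ i j, p i → p j → i ≠ j →
      P i j ≤ Submodule.span F {E i j} ⊔ traceRadical (∑ m, t m)) :
    IsPeirceComplement e (traceRadical (∑ m, t m)) p fun i j => Submodule.span F {E i j} where
  le i j hi hj := by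
    rw [Submodule.span_singleton_le_iff_mem]
    exact M.mem i j hi hj
  le_sup i j hi hj := by
    by_cases hij : i = j
    · subst hij
      rw [M.unit i hi]
      exact diag_le_span_sup h h2 H T i
    · exact hE i j hi hj hij
  inf_eq_bot i j hi hj := by
    rw [eq_bot_iff]
    rintro x ⟨hx, hK⟩
    obtain ⟨c, rfl⟩ := Submodule.mem_span_singleton.1 hx
    by_cases hc : c = 0
    · rw [hc, zero_smul]; exact zero_mem _
    · have := (traceRadical (∑ m, t m)).smul_mem c⁻¹ hK
      rw [inv_smul_smul₀ hc] at this
      have := ((isTwoSidedIdeal_traceRadical h h2 H T h3) _ this (E j i)).2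
      rw [M.mul i j i hi hj hi, M.unit i hi] at this
      exact absurd this (unit_notMem_traceRadical h h2 H T i)
  mul_mem i j k hi hj hk x hx y hy := by
    obtain ⟨c, rfl⟩ := Submodule.mem_span_singleton.1 hx
    obtain ⟨d, rfl⟩ := Submodule.mem_span_singleton.1 hy
    rw [smul_mul_assoc, mul_smul_comm, M.mul i j k hi hj hk]
    exact Submodule.smul_mem _ _ (Submodule.smul_mem _ _ (Submodule.mem_span_singleton_self _))
  mul_mem_swap i j hi hj hij x hx y hy := by
    obtain ⟨c, rfl⟩ := Submodule.mem_span_singleton.1 hx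
    obtain ⟨d, rfl⟩ := Submodule.mem_span_singleton.1 hy
    rw [smul_mul_assoc, mul_smul_comm, mul_self_eq_zero h h2 H hij (M.mem i j hi hj), smul_zero,
      smul_zero]
    exact zero_mem _

theorem exists_isCayleyFrame_of_notMem {i j : ι} (hij : i ≠ j) {f g x : A} (hf : f ∈ P i j)
    (hg : g ∈ P j i) (hfg : f * g = e i) (hx : x ∈ P i j)
    (hxE : x ∉ Submodule.span F {f} ⊔ traceRadical (∑ m, t m)) :
    ∃ u v, IsCayleyFrame F e i j u v := by
  have hI := isTwoSidedIdeal_traceRadical h h2 H T h3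
  set K := traceRadical (∑ m, t m) with hK
  set c := t i (x * g)
  have hx' : x - c • f ∈ P i j := (P i j).sub_mem hx ((P i j).smul_mem _ hf)
  have hxK : x - c • f ∉ K := fun hh => hxE (Submodule.mem_sup.2
    ⟨_, Submodule.smul_mem _ c (Submodule.mem_span_singleton_self f), _, hh, add_sub_cancel _ _⟩)
  have ht : (x - c • f) * g ∈ K := by
    rw [sub_mul, smul_mul_assoc, hfg]
    exact sub_smul_unit_mem h h2 H T (mul_mem h h2 H hx hg)
  generalize x - c • f = z at hx' hxK ht
  have hgz : g * z ∈ K := mul_mem_traceRadical_swap h h2 H T hx' hg ht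
  have hzf : z * f ∉ K := by
    intro hh
    have e1 := h.cyclic z f g
    rw [hfg, mul_unit h h2 H hx' hij, hx'.1, sub_zero] at e1
    refine hxK ?_
    have : z = z * f * g + f * (g * z) := by rw [e1]; abel
    rw [this]
    exact K.add_mem (hI _ hh _).2 (hI _ hgz _).1
  have hzfm := mul_mem_swap h h2 H hij hx' hf
  rw [hK, mem_traceRadical_iff h h2 H T hzfm] at hzf
  push Not at hzf
  obtain ⟨w, hw, hwt⟩ := hzf
  rw [mul_swap h h2 H T hzfm hw] at hwt
  obtain ⟨d, hd, hdc, -⟩ := T.inverse i _ (mul_mem h h2 H hw hzfm) hwt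
  refine exists_isCayleyFrame h h2 H hij (mul_mem h h2 H hd hw) hx' hf ?_
  rw [mul_assoc_of_mem h h2 H (fun hh => hij hh.1.symm) hd hw hzfm, hdc]

open Classical in
theorem isPeirceComplement_of_isCayleyFrame {p : ι → Prop} {i j : ι} (hij : i ≠ j)
    (hp : ∀ k, p k → k = i ∨ k = j) {u v : Fin 3 → A} (C : IsCayleyFrame F e i j u v) :
    IsPeirceComplement e (traceRadical (∑ m, t m)) p fun a b =>
      if a = b then Submodule.span F {e a} else
        if a = i then Submodule.span F (Set.range u) else Submodule.span F (Set.range v) := by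
  have hneg : ∀ w : Fin 3 → A, Submodule.span F (Set.range fun k => -w k) =
      Submodule.span F (Set.range w) := by
    intro w
    apply le_antisymm <;> rw [Submodule.span_le] <;> rintro _ ⟨k, rfl⟩
    · exact neg_mem (Submodule.subset_span ⟨k, rfl⟩)
    · rw [← neg_neg (w k)]
      exact neg_mem (Submodule.subset_span ⟨k, rfl⟩)
  have C' := C.symm
  have hu : Submodule.span F (Set.range u) ≤ P i j := by
    rw [Submodule.span_le]; rintro _ ⟨k, rfl⟩; exact C.left_mem k
  have hv : Submodule.span F (Set.range v) ≤ P j i := by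
    rw [Submodule.span_le]; rintro _ ⟨k, rfl⟩; exact C.right_mem k
  have unit_mul_mem : ∀ (a b : ι) (W : Submodule F A), W ≤ P a b →
      ∀ x ∈ Submodule.span F {e a}, ∀ y ∈ W, x * y ∈ W := by
    intro a b W hW x hx y hy
    obtain ⟨c, rfl⟩ := Submodule.mem_span_singleton.1 hx
    rw [smul_mul_assoc, (hW hy).1]
    exact W.smul_mem c hy
  have mul_unit_mem : ∀ (a b : ι) (W : Submodule F A), W ≤ P a b →
      ∀ x ∈ W, ∀ y ∈ Submodule.span F {e b}, x * y ∈ W := by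
    intro a b W hW x hx y hy
    obtain ⟨c, rfl⟩ := Submodule.mem_span_singleton.1 hy
    rw [mul_smul_comm, (hW hx).2]
    exact W.smul_mem c hx
  have hunit : ∀ a, Submodule.span F {e a} ≤ P a a := by
    intro a
    rw [Submodule.span_singleton_le_iff_mem]
    exact H.unit_mem a
  constructor
  · intro a b ha hb
    rcases hp a ha with rfl | rfl <;> rcases hp b hb with rfl | rfl
    · simpa using hunit _
    · simpa [hij] using hu
    · simpa [hij.symm] using hv
    · simpa using hunit _
  · intro a b ha hb
    rcases hp a ha with rfl | rfl <;> rcases hp b hb with rfl | rfl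
    · simpa using diag_le_span_sup h h2 H T _
    · simpa [hij] using le_span_sup_of_isCayleyFrame h h2 H T h3 hij C
    · have := le_span_sup_of_isCayleyFrame h h2 H T h3 hij.symm C'
      rw [hneg] at this
      simpa [hij.symm] using this
    · simpa using diag_le_span_sup h h2 H T _
  · intro a b ha hb
    rcases hp a ha with rfl | rfl <;> rcases hp b hb with rfl | rfl
    · simpa using span_unit_inf h h2 H T _
    · simpa [hij] using span_inf_eq_bot_of_isCayleyFrame h h2 H T h3 C
    · have := span_inf_eq_bot_of_isCayleyFrame h h2 H T h3 C'
      rw [hneg] at this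
      simpa [hij.symm] using this
    · simpa using span_unit_inf h h2 H T _
  · intro a b c ha hb hc
    rcases hp a ha with rfl | rfl <;> rcases hp b hb with rfl | rfl <;>
      rcases hp c hc with rfl | rfl <;> simp only [if_true, if_neg hij, if_neg hij.symm]
    · exact unit_mul_mem _ _ _ (hunit _)
    · exact unit_mul_mem _ _ _ hu
    · exact fun x hx y hy => C.mul_mem_span_unit hx hy
    · exact mul_unit_mem _ _ _ hu
    · exact mul_unit_mem _ _ _ hv
    · intro x hx y hy
      rw [← hneg] at hx hy
      exact C'.mul_mem_span_unit hx hy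
    · exact unit_mul_mem _ _ _ hv
    · exact unit_mul_mem _ _ _ (hunit _)
  · intro a b ha hb hab
    rcases hp a ha with rfl | rfl <;> rcases hp b hb with rfl | rfl <;>
      simp only [if_neg hij, if_neg hij.symm, if_true]
    · exact absurd rfl hab
    · exact fun x hx y hy => C.mul_mem_span h h2 H hij hx hy
    · intro x hx y hy
      rw [← hneg] at hx hy ⊢
      exact C'.mul_mem_span h h2 H hij.symm hx hy
    · exact absurd rfl hab

theorem exists_isPeirceComplement_class (r : ι) : ∃ S,
    IsPeirceComplement e (traceRadical (∑ m, t m)) (PeirceLinked F e r) S := by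
  classical
  obtain ⟨E, M⟩ := exists_isMatrixUnits h h2 H (F := F) r
  by_cases hE : ∀ i j, PeirceLinked F e r i → PeirceLinked F e r j → i ≠ j →
      P i j ≤ Submodule.span F {E i j} ⊔ traceRadical (∑ m, t m)
  · exact ⟨_, isPeirceComplement_of_isMatrixUnits h h2 H T h3 M hE⟩
  push Not at hE
  obtain ⟨i, j, hi, hj, hij, hE⟩ := hE
  have hp : ∀ k, PeirceLinked F e r k → k = i ∨ k = j := by
    intro k hk
    by_contra! hne
    exact hE (le_span_sup_of_third_index h h2 H T h3 M hi hj hk hne.1 hne.2)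
  obtain ⟨x, hx, hxE⟩ := Set.not_subset.1 hE
  obtain ⟨u, v, C⟩ := exists_isCayleyFrame_of_notMem h h2 H T h3 hij (M.mem i j hi hj)
    (M.mem j i hj hi) (by rw [M.mul i j i hi hj hi, M.unit i hi]) hx hxE
  exact ⟨_, isPeirceComplement_of_isCayleyFrame h h2 H T h3 hij hp C⟩

theorem exists_isPeirceComplement : ∃ S,
    IsPeirceComplement e (traceRadical (∑ m, t m)) (fun _ => True) S := by
  classical
  let s : Setoid ι := ⟨PeirceLinked F e, PeirceLinked.refl H, PeirceLinked.symm,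
    linked_trans h h2 H⟩
  let rep : ι → ι := fun i => Quotient.out (Quotient.mk s i)
  have hrep : ∀ i, PeirceLinked F e (rep i) i := fun i => Quotient.mk_out (s := s) i
  have hreq : ∀ i j, PeirceLinked F e i j → rep i = rep j := fun i j hij =>
    congrArg Quotient.out (Quotient.sound (s := s) hij)
  choose S hS using exists_isPeirceComplement_class h h2 H T h3
  have hS' := fun i j (hij : PeirceLinked F e i j) => hreq i j hij ▸ hrep j
  refine ⟨fun i j => if PeirceLinked F e i j then S (rep i) i j else ⊥, ?_, ?_, ?_, ?_, ?_⟩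
  · intro i j _ _
    split_ifs with hij
    · exact (hS _).le i j (hrep i) (hS' i j hij)
    · exact bot_le
  · intro i j _ _
    split_ifs with hij
    · exact (hS _).le_sup i j (hrep i) (hS' i j hij)
    · rw [bot_sup_eq]; exact le_traceRadical_of_not_linked h h2 H T hij
  · intro i j _ _
    split_ifs with hij
    · exact (hS _).inf_eq_bot i j (hrep i) (hS' i j hij)
    · exact bot_inf_eq _
  · intro i j k _ _ _ x hx y hy
    by_cases hij : PeirceLinked F e i j
    · by_cases hjk : PeirceLinked F e j k
      · have hik := linked_trans h h2 H hij hjk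
        rw [if_pos hij] at hx
        rw [if_pos hjk, ← hreq i j hij] at hy
        rw [if_pos hik]
        exact (hS _).mul_mem i j k (hrep i) (hS' i j hij) (hS' i k hik) x hx y hy
      · rw [if_neg hjk, Submodule.mem_bot] at hy
        rw [hy, mul_zero]; exact zero_mem _
    · rw [if_neg hij, Submodule.mem_bot] at hx
      rw [hx, zero_mul]; exact zero_mem _
  · intro i j _ _ hne x hx y hy
    by_cases hij : PeirceLinked F e i j
    · rw [if_pos hij] at hx hy
      rw [if_pos hij.symm, ← hreq i j hij]
      exact (hS _).mul_mem_swap i j (hrep i) (hS' i j hij) hne x hx y hy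
    · rw [if_neg hij, Submodule.mem_bot] at hx
      rw [hx, zero_mul]; exact zero_mem _

theorem exists_subalgebra_complement : ∃ S : NonUnitalSubalgebra F A,
    S.toSubmodule ⊔ traceRadical (∑ m, t m) = ⊤ ∧
      S.toSubmodule ⊓ traceRadical (∑ m, t m) = ⊥ := by
  obtain ⟨S, hS⟩ := exists_isPeirceComplement h h2 H T h3
  have hI := isTwoSidedIdeal_traceRadical h h2 H T h3
  let W : Submodule F A :=
    { carrier := {x | ∀ i j, e i * (x * e j) ∈ S i j}
      add_mem' := fun hx hy i j => by
        rw [add_mul, mul_add]; exact add_mem (hx i j) (hy i j)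
      zero_mem' := fun i j => by rw [zero_mul, mul_zero]; exact zero_mem _
      smul_mem' := fun c x hx i j => by
        rw [smul_mul_assoc, mul_smul_comm]; exact Submodule.smul_mem _ c (hx i j) }
  have hSW : ∀ i j, S i j ≤ W := by
    intro i j x hx k l
    have hxP := hS.le i j trivial trivial hx
    by_cases hl : l = j
    · subst hl
      rw [hxP.2]
      by_cases hk : k = i
      · subst hk; rwa [hxP.1]
      · rw [unit_mul h h2 H hxP hk]; exact zero_mem _
    · rw [mul_unit h h2 H hxP hl, mul_zero]; exact zero_mem _
  have hmul : ∀ x ∈ W, ∀ y ∈ W, x * y ∈ W := by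
    intro x hx y hy
    rw [← sum_component h h2 H x, ← sum_component h h2 H y]
    simp only [Finset.sum_mul, Finset.mul_sum]
    refine W.sum_mem fun k _ => W.sum_mem fun l _ => W.sum_mem fun i _ => W.sum_mem fun j _ => ?_
    have hx' := hx i j
    have hy' := hy k l
    have hxP := hS.le i j trivial trivial hx'
    have hyP := hS.le k l trivial trivial hy'
    by_cases hjk : j = k
    · subst hjk
      exact hSW _ _ (hS.mul_mem i j l trivial trivial trivial _ hx' _ hy')
    by_cases hh : i = k ∧ j = l
    · obtain ⟨rfl, rfl⟩ := hh
      exact hSW _ _ (hS.mul_mem_swap i j trivial trivial (Ne.symm hjk) _ hx' _ hy')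
    · rw [mul_eq_zero h h2 H hjk hh hxP hyP]; exact zero_mem _
  refine ⟨{ W with mul_mem' := fun hx hy => hmul _ hx _ hy }, ?_, ?_⟩
  · rw [eq_top_iff]
    intro x _
    rw [← sum_component h h2 H x]
    refine Submodule.sum_mem _ fun i _ => Submodule.sum_mem _ fun j _ => ?_
    exact sup_le_sup_right (hSW i j) _ (hS.le_sup i j trivial trivial (component_mem h h2 H i j x))
  · rw [eq_bot_iff]
    rintro x ⟨hx, hK⟩
    rw [← sum_component h h2 H x]
    refine Submodule.sum_mem _ fun i _ => Submodule.sum_mem _ fun j _ => ?_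
    rw [← hS.inf_eq_bot i j trivial trivial]
    exact ⟨hx i j, (hI _ (hI _ hK _).2 _).1⟩

end IsPeirceCharacter

end Classes

section Transfer

/-- An ideal `K` and a complementary subalgebra `S` of a nonassociative algebra, such that the
ideals containing `K` are complemented modulo `K` and `K` is nilpotent on the left. -/
structure IsWedderburnPair {F A : Type*} [Field F] [NonUnitalNonAssocRing A] [Module F A]
    [SMulCommClass F A A] [IsScalarTower F A A] (K : Submodule F A)
    (S : NonUnitalSubalgebra F A) : Prop where
  ideal : IsTwoSidedIdeal K
  sup_eq_top : S.toSubmodule ⊔ K = ⊤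
  inf_eq_bot : S.toSubmodule ⊓ K = ⊥
  exists_complement : ∀ I : Submodule F A, IsTwoSidedIdeal I → K ≤ I →
    ∃ I' : Submodule F A, IsTwoSidedIdeal I' ∧ I ⊔ I' = ⊤ ∧ I ⊓ I' = K
  nilpotent : ∃ n, iteratedLeftMul K n = ⊥

theorem IsAlternative.exists_isWedderburnPair_of_unital {F A : Type*} [Field F] [IsAlgClosed F]
    [NonAssocRing A] [Module F A] [SMulCommClass F A A] [IsScalarTower F A A]
    [FiniteDimensional F A] [Nontrivial A] (h : IsAlternative A) (h2 : (2 : F) ≠ 0)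
    (h3 : (3 : F) ≠ 0) :
    ∃ (K : Submodule F A) (S : NonUnitalSubalgebra F A), IsWedderburnPair K S := by
  obtain ⟨X, H⟩ := exists_isPeirceSystem (F := F) h h2
  obtain ⟨t, T⟩ := IsPeirceSystem.exists_isPeirceCharacter h h2 H
  obtain ⟨S, hS⟩ := IsPeirceCharacter.exists_subalgebra_complement h h2 H T h3
  exact ⟨_, S, IsPeirceCharacter.isTwoSidedIdeal_traceRadical h h2 H T h3, hS.1, hS.2,
    fun I hI hKI => IsPeirceCharacter.exists_ideal_complement h h2 H T h3 hI hKI,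
    IsPeirceCharacter.exists_iteratedLeftMul_traceRadical_eq_bot h h2 H T h3⟩

variable {F U : Type*} [Field F] [NonUnitalNonAssocRing U] [Module F U]

theorem Unitization.smulCommClass_self [SMulCommClass F U U] :
    SMulCommClass F (Unitization F U) (Unitization F U) where
  smul_comm r x y := by
    apply Unitization.ext
    · simp [mul_left_comm]
    · simp [smul_smul, mul_comm, mul_smul_comm]

theorem Unitization.isScalarTower_self [IsScalarTower F U U] :
    IsScalarTower F (Unitization F U) (Unitization F U) where
  smul_assoc r x y := by
    apply Unitization.ext
    · simp [mul_assoc]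
    · simp [smul_smul, mul_comm, smul_mul_assoc]

variable [SMulCommClass F U U] [IsScalarTower F U U]

theorem IsAlternative.unitization (h : IsAlternative U) : IsAlternative (Unitization F U) := by
  intro x y
  constructor
  · apply Unitization.ext
    · simp [mul_assoc]
    · simp only [Unitization.snd_mul, Unitization.fst_mul, smul_add, mul_add, add_mul,
        smul_mul_assoc, mul_smul_comm, smul_smul, (h _ _).1]
      module
  · apply Unitization.ext
    · simp [mul_assoc]
    · simp only [Unitization.snd_mul, Unitization.fst_mul, smul_add, mul_add, add_mul,
        smul_mul_assoc, mul_smul_comm, smul_smul, (h _ _).2]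
      module

theorem IsAlternative.exists_isWedderburnPair [IsAlgClosed F] [FiniteDimensional F U]
    (h : IsAlternative U) (h2 : (2 : F) ≠ 0) (h3 : (3 : F) ≠ 0) :
    ∃ (K : Submodule F U) (S : NonUnitalSubalgebra F U), IsWedderburnPair K S := by
  have := Unitization.smulCommClass_self (F := F) (U := U)
  have := Unitization.isScalarTower_self (F := F) (U := U)
  have : FiniteDimensional F (Unitization F U) :=
    Module.Finite.equiv (Unitization.linearEquiv F F U).symm
  have : Nontrivial (Unitization F U) := ⟨⟨1, 0, fun h0 =>
    one_ne_zero (congrArg (fun z : Unitization F U => z.fst) h0)⟩⟩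
  obtain ⟨K, S, W⟩ := (h.unitization (F := F)).exists_isWedderburnPair_of_unital h2 h3
  let f : U →ₗ[F] Unitization F U := Unitization.inrHom F F U
  have hf : ∀ x y, f (x * y) = f x * f y := fun x y => Unitization.inr_mul F x y
  have hinj : Function.Injective f := Unitization.inr_injective
  have hK : K ≤ LinearMap.range f := by
    intro k hk
    have hpow : ∀ n, ∃ z ∈ iteratedLeftMul K n, z.fst = k.fst ^ n := by
      intro n
      induction n with
      | zero => exact ⟨1, trivial, by simp⟩
      | succ n ih =>
        obtain ⟨z, hz, hz'⟩ := ih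
        exact ⟨k * z, Submodule.apply_mem_map₂ (LinearMap.mul F (Unitization F U)) hk hz,
          by rw [Unitization.fst_mul, hz', pow_succ']⟩
    obtain ⟨n, hn⟩ := W.nilpotent
    obtain ⟨z, hz, hz'⟩ := hpow n
    rw [hn, Submodule.mem_bot] at hz
    rw [hz, Unitization.fst_zero] at hz'
    refine ⟨k.snd, Unitization.ext ?_ rfl⟩
    exact (eq_zero_of_pow_eq_zero hz'.symm).symm
  have hrange : ∀ a : Unitization F U, ∃ v, a = Unitization.inl a.fst + f v :=
    fun a => ⟨a.snd, (Unitization.inl_fst_add_inr_snd_eq a).symm⟩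
  have hcomap : ∀ I : Submodule F (Unitization F U), IsTwoSidedIdeal I →
      IsTwoSidedIdeal (I.comap f) := by
    intro I hI x hx u
    exact ⟨by rw [Submodule.mem_comap, hf]; exact (hI _ hx _).1,
      by rw [Submodule.mem_comap, hf]; exact (hI _ hx _).2⟩
  refine ⟨K.comap f, { S.toSubmodule.comap f with
    mul_mem' := fun {x y} hx hy => by
      change f (x * y) ∈ S
      rw [hf]; exact S.mul_mem hx hy }, hcomap K W.ideal, ?_, ?_, ?_, ?_⟩
  · rw [eq_top_iff]
    intro x _
    obtain ⟨s, hs, k, hk, hsk⟩ := Submodule.mem_sup.1 (W.sup_eq_top ▸ Submodule.mem_top :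
      f x ∈ S.toSubmodule ⊔ K)
    obtain ⟨k, rfl⟩ := hK hk
    refine Submodule.mem_sup.2 ⟨x - k, ?_, k, hk, sub_add_cancel _ _⟩
    change f (x - k) ∈ S
    rwa [map_sub, ← hsk, add_sub_cancel_right]
  · rw [eq_bot_iff]
    rintro x ⟨hx, hxK⟩
    refine hinj ?_
    have : f x ∈ S.toSubmodule ⊓ K := ⟨hx, hxK⟩
    rw [W.inf_eq_bot, Submodule.mem_bot] at this
    rw [this, map_zero]
  · intro I hI hKI
    have hIf : IsTwoSidedIdeal (I.map f) := by
      rintro _ ⟨x, hx, rfl⟩ a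
      obtain ⟨v, hv⟩ := hrange a
      have e1 : a * f x = f (a.fst • x + v * x) := by
        conv_lhs => rw [hv]
        rw [add_mul, map_add, hf]
        congr 1
        exact Unitization.inl_mul_inr _ _
      have e2 : f x * a = f (a.fst • x + x * v) := by
        conv_lhs => rw [hv]
        rw [mul_add, map_add, hf]
        congr 1
        exact Unitization.inr_mul_inl _ _
      rw [e1, e2]
      exact ⟨Submodule.mem_map_of_mem (I.add_mem (I.smul_mem _ hx) (hI x hx v).1),
        Submodule.mem_map_of_mem (I.add_mem (I.smul_mem _ hx) (hI x hx v).2)⟩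
    have hKf : K ≤ I.map f := by
      intro k hk
      obtain ⟨k, rfl⟩ := hK hk
      exact Submodule.mem_map_of_mem (hKI hk)
    obtain ⟨I', hI', hsup, hinf⟩ := W.exists_complement _ hIf hKf
    refine ⟨I'.comap f, hcomap I' hI', ?_, ?_⟩
    · rw [eq_top_iff]
      intro x _
      obtain ⟨_, ⟨y, hy, rfl⟩, k, hk, hsk⟩ := Submodule.mem_sup.1
        (hsup ▸ Submodule.mem_top : f x ∈ I.map f ⊔ I')
      refine Submodule.mem_sup.2 ⟨y, hy, x - y, ?_, add_sub_cancel _ _⟩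
      rwa [Submodule.mem_comap, map_sub, ← hsk, add_sub_cancel_left]
    · rw [← hinf, Submodule.comap_inf, Submodule.comap_map_eq_of_injective hinj]
  · obtain ⟨n, hn⟩ := W.nilpotent
    refine ⟨n, ?_⟩
    have hle : ∀ m, (iteratedLeftMul (K.comap f) m).map f ≤ iteratedLeftMul K m := by
      intro m
      induction m with
      | zero => exact le_top
      | succ m ih =>
        rw [Submodule.map_le_iff_le_comap, iteratedLeftMul, Submodule.map₂_le]
        intro k hk z hz
        change f (k * z) ∈ iteratedLeftMul K (m + 1)
        rw [hf]
        exact Submodule.apply_mem_map₂ (LinearMap.mul F (Unitization F U)) hk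
          (ih (Submodule.mem_map_of_mem hz))
    rw [eq_bot_iff]
    intro x hx
    refine hinj ?_
    have := hle n (Submodule.mem_map_of_mem hx)
    rw [hn, Submodule.mem_bot] at this
    rw [this, map_zero]

end Transfer

section Baric

set_option linter.unusedSectionVars false

variable {F U : Type*} [Field F] [NonUnitalNonAssocRing U] [Module F U]
  [SMulCommClass F U U] [IsScalarTower F U U] {ω : U →ₗ[F] F}

theorem IsTwoSidedIdeal.sup {I J : Submodule F U} (hI : IsTwoSidedIdeal I)
    (hJ : IsTwoSidedIdeal J) : IsTwoSidedIdeal (I ⊔ J) := by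
  intro x hx u
  obtain ⟨y, hy, z, hz, rfl⟩ := Submodule.mem_sup.1 hx
  rw [mul_add, add_mul]
  exact ⟨Submodule.add_mem_sup (hI y hy u).1 (hJ z hz u).1,
    Submodule.add_mem_sup (hI y hy u).2 (hJ z hz u).2⟩

theorem IsTwoSidedIdeal.inf {I J : Submodule F U} (hI : IsTwoSidedIdeal I)
    (hJ : IsTwoSidedIdeal J) : IsTwoSidedIdeal (I ⊓ J) := fun x hx u =>
  ⟨⟨(hI x hx.1 u).1, (hJ x hx.2 u).1⟩, ⟨(hI x hx.1 u).2, (hJ x hx.2 u).2⟩⟩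

theorem IsAlternative.isTwoSidedIdeal_map₂_self (h : IsAlternative U) {K : Submodule F U}
    (hK : IsTwoSidedIdeal K) :
    IsTwoSidedIdeal (Submodule.map₂ (LinearMap.mul F U) K K) := by
  intro x hx u
  have hm : ∀ a ∈ K, ∀ b ∈ K, a * b ∈ Submodule.map₂ (LinearMap.mul F U) K K :=
    fun a ha b hb => Submodule.apply_mem_map₂ (LinearMap.mul F U) ha hb
  rw [Submodule.map₂_eq_span_image2] at hx
  induction hx using Submodule.span_induction with
  | mem x hx =>
    obtain ⟨a, ha, b, hb, rfl⟩ := hx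
    change u * (a * b) ∈ _ ∧ a * b * u ∈ _
    have e1 : u * (a * b) = u * a * b + a * u * b - a * (u * b) := by
      have := h.left_linearized u a b
      rw [this]; abel
    have e2 : a * b * u = a * (b * u) + a * (u * b) - a * u * b := by
      have := h.right_linearized a b u
      rw [← this]; abel
    rw [e1, e2]
    exact ⟨sub_mem (add_mem (hm _ (hK a ha u).1 _ hb) (hm _ (hK a ha u).2 _ hb))
        (hm _ ha _ (hK b hb u).1),
      sub_mem (add_mem (hm _ ha _ (hK b hb u).2) (hm _ ha _ (hK b hb u).1))
        (hm _ (hK a ha u).2 _ hb)⟩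
  | zero => rw [mul_zero, zero_mul]; exact ⟨zero_mem _, zero_mem _⟩
  | add x y _ _ hx hy => rw [mul_add, add_mul]; exact ⟨add_mem hx.1 hy.1, add_mem hx.2 hy.2⟩
  | smul c x _ hx =>
    rw [mul_smul_comm, smul_mul_assoc]
    exact ⟨Submodule.smul_mem _ c hx.1, Submodule.smul_mem _ c hx.2⟩

/-- Nakayama's lemma for an ideal acting nilpotently from the left. -/
theorem le_of_le_map₂_sup {K M N : Submodule F U} (hM : IsTwoSidedIdeal M)
    (hK : ∃ n, iteratedLeftMul K n = ⊥)
    (hN : N ≤ Submodule.map₂ (LinearMap.mul F U) K N ⊔ M) : N ≤ M := by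
  obtain ⟨n, hn⟩ := hK
  have hle : ∀ m, N ≤ iteratedLeftMul K m ⊔ M := by
    intro m
    induction m with
    | zero => exact le_top.trans le_sup_left
    | succ m ih =>
      refine hN.trans (sup_le ?_ le_sup_right)
      rw [Submodule.map₂_le]
      intro k hk x hx
      obtain ⟨y, hy, z, hz, rfl⟩ := Submodule.mem_sup.1 (ih hx)
      rw [map_add]
      exact Submodule.add_mem_sup (Submodule.apply_mem_map₂ (LinearMap.mul F U) hk hy)
        (hM z hz k).1
  have := hle n
  rwa [hn, bot_sup_eq] at this

variable (hω : ∀ x y : U, ω (x * y) = ω x * ω y)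
include hω

theorem isTwoSidedIdeal_ker : IsTwoSidedIdeal (LinearMap.ker ω) := by
  intro x hx u
  rw [LinearMap.mem_ker] at hx
  simp [LinearMap.mem_ker, hω, hx]

theorem le_ker_of_iteratedLeftMul_eq_bot {K : Submodule F U}
    (hK : ∃ n, iteratedLeftMul K n = ⊥) : K ≤ LinearMap.ker ω := by
  obtain ⟨n, hn⟩ := hK
  intro k hk
  have hpow : ∀ n, ∃ z ∈ iteratedLeftMul K n, ω z = ω k ^ (n + 1) := by
    intro n
    induction n with
    | zero => exact ⟨k, trivial, by simp⟩
    | succ n ih =>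
      obtain ⟨z, hz, hz'⟩ := ih
      exact ⟨k * z, Submodule.apply_mem_map₂ (LinearMap.mul F U) hk hz,
        by rw [hω, hz', pow_succ' _ (n + 1)]⟩
  obtain ⟨z, hz, hz'⟩ := hpow n
  rw [hn, Submodule.mem_bot] at hz
  rw [hz, map_zero] at hz'
  exact eq_zero_of_pow_eq_zero hz'.symm

omit hω in
theorem IsNormalBSubalgebra.isTwoSidedIdeal {B : NonUnitalSubalgebra F U}
    (hB : IsNormalBSubalgebra F U ω B) : IsTwoSidedIdeal (B.toSubmodule ⊓ LinearMap.ker ω) :=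
  fun x hx u => hB.2 x hx u

/-- The subalgebra spanned by an ideal of weight zero and an idempotent of weight one modulo
that ideal. -/
def adjoinIdempotent (M : Submodule F U) (hM : IsTwoSidedIdeal M) (e : U) (he : e * e - e ∈ M) :
    NonUnitalSubalgebra F U where
  carrier := {x | x - ω x • e ∈ M}
  add_mem' {x y} hx hy := by
    have : x + y - ω (x + y) • e = (x - ω x • e) + (y - ω y • e) := by
      rw [map_add, add_smul]; abel
    change x + y - ω (x + y) • e ∈ M
    rw [this]; exact add_mem hx hy
  zero_mem' := by simp
  smul_mem' c x hx := by
    change c • x - ω (c • x) • e ∈ M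
    rw [map_smul, smul_assoc, ← smul_sub]
    exact M.smul_mem c hx
  mul_mem' {x y} hx hy := by
    change x * y - ω (x * y) • e ∈ M
    have : x * y - ω (x * y) • e = (x - ω x • e) * y + ω x • (e * (y - ω y • e)) +
        (ω x * ω y) • (e * e - e) := by
      rw [hω]
      simp only [sub_mul, mul_sub, smul_sub, mul_smul_comm, smul_mul_assoc, smul_smul]
      abel
    rw [this]
    exact add_mem (add_mem (hM _ hx _).2 (M.smul_mem _ (hM _ hy _).1)) (M.smul_mem _ he)

section Adjoin

variable {M : Submodule F U} (hM : IsTwoSidedIdeal M) (hMω : M ≤ LinearMap.ker ω) {e : U}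
  (he : e * e - e ∈ M) (heω : ω e = 1)

theorem mem_adjoinIdempotent_self (heω : ω e = 1) : e ∈ adjoinIdempotent hω M hM e he := by
  change e - ω e • e ∈ M
  rw [heω, one_smul, sub_self]
  exact zero_mem _

include hMω

theorem le_adjoinIdempotent : M ≤ (adjoinIdempotent hω M hM e he).toSubmodule := by
  intro x hx
  change x - ω x • e ∈ M
  rwa [LinearMap.mem_ker.1 (hMω hx), zero_smul, sub_zero]

theorem barSet_adjoinIdempotent : barSet F U ω (adjoinIdempotent hω M hM e he) = M := by
  ext x
  constructor
  · rintro ⟨hx, hx0⟩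
    change x - ω x • e ∈ M at hx
    rwa [hx0, zero_smul, sub_zero] at hx
  · intro hx
    exact ⟨le_adjoinIdempotent hω hM hMω he hx, hMω hx⟩

include heω

theorem isNormalBSubalgebra_adjoinIdempotent :
    IsNormalBSubalgebra F U ω (adjoinIdempotent hω M hM e he) := by
  refine ⟨⟨e, mem_adjoinIdempotent_self hω hM he heω, by rw [heω]; exact one_ne_zero⟩, ?_⟩
  rw [barSet_adjoinIdempotent hω hM hMω he]
  exact hM

theorem isMaximalNormalBSubalgebra_adjoinIdempotent
    (hmax : ∀ C, IsTwoSidedIdeal C → M ≤ C → C ≤ LinearMap.ker ω → C = M ∨ C = LinearMap.ker ω) :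
    IsMaximalNormalBSubalgebra F U ω (adjoinIdempotent hω M hM e he) := by
  refine ⟨isNormalBSubalgebra_adjoinIdempotent hω hM hMω he heω, ?_⟩
  rintro ⟨C, hC, hBC, hCtop⟩
  have heC : e ∈ C := hBC.le (mem_adjoinIdempotent_self hω hM he heω)
  rcases hmax _ hC.isTwoSidedIdeal
    (le_inf ((le_adjoinIdempotent hω hM hMω he).trans hBC.le) hMω) inf_le_right with h0 | h0
  · refine hBC.not_ge fun x hx => ?_
    change x - ω x • e ∈ M
    rw [← h0]
    refine ⟨sub_mem hx (C.smul_mem _ heC), ?_⟩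
    simp [heω]
  · refine hCtop.not_ge fun x _ => ?_
    have : x - ω x • e ∈ C.toSubmodule ⊓ LinearMap.ker ω := by
      rw [h0]; simp [heω]
    rw [← sub_add_cancel x (ω x • e)]
    exact C.add_mem this.1 (C.smul_mem _ heC)

end Adjoin

omit hω in
theorem exists_submodule_eq_bRad : ∃ R : Submodule F U, (R : Set U) = bRad F U ω := by
  unfold bRad
  split_ifs
  · exact ⟨⊥, rfl⟩
  · refine ⟨⨅ B ∈ {B : NonUnitalSubalgebra F U | IsMaximalNormalBSubalgebra F U ω B},
      B.toSubmodule ⊓ LinearMap.ker ω, ?_⟩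
    simp only [Submodule.coe_iInf]
    rfl

theorem mem_of_mem_bRad [FiniteDimensional F U] {K : Submodule F U} (hK : IsTwoSidedIdeal K)
    (hKω : K ≤ LinearMap.ker ω)
    (hcompl : ∀ I : Submodule F U, IsTwoSidedIdeal I → K ≤ I →
      ∃ I' : Submodule F U, IsTwoSidedIdeal I' ∧ I ⊔ I' = ⊤ ∧ I ⊓ I' = K)
    {e : U} (he : e * e = e) (heω : ω e = 1) {x : U} (hx : x ∈ bRad F U ω) : x ∈ K := by
  have hω0 : ω ≠ 0 := by
    rintro rfl; exact zero_ne_one heω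
  by_contra hxK
  obtain ⟨M, ⟨hM, hKM, hMω, hxM⟩, hmax⟩ := WellFounded.has_min
    (wellFounded_gt (α := Submodule F U))
    {M | IsTwoSidedIdeal M ∧ K ≤ M ∧ M ≤ LinearMap.ker ω ∧ x ∉ M} ⟨K, hK, le_rfl, hKω, hxK⟩
  have hmax' : ∀ C, IsTwoSidedIdeal C → M ≤ C → C ≤ LinearMap.ker ω →
      C = M ∨ C = LinearMap.ker ω := by
    intro C hC hMC hCω
    by_cases hxC : x ∈ C
    · right
      obtain ⟨C', hC', hsup, hinf⟩ := hcompl C hC (hKM.trans hMC)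
      have hD := hM.sup (hC'.inf (isTwoSidedIdeal_ker hω))
      have hxD : x ∉ M ⊔ C' ⊓ LinearMap.ker ω := by
        intro hxD
        have : x ∈ (M ⊔ C' ⊓ LinearMap.ker ω) ⊓ C := ⟨hxD, hxC⟩
        rw [sup_inf_assoc_of_le _ hMC] at this
        refine hxM ((sup_le le_rfl ?_ : M ⊔ C' ⊓ LinearMap.ker ω ⊓ C ≤ M) this)
        refine le_trans ?_ hKM
        rw [← hinf]
        exact le_inf inf_le_right (inf_le_left.trans inf_le_left)
      have hDM := hmax _ ⟨hD, hKM.trans le_sup_left, sup_le hMω inf_le_right, hxD⟩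
      have hle : C' ⊓ LinearMap.ker ω ≤ M := by
        by_contra hh
        exact hDM (lt_of_le_of_ne le_sup_left fun h0 => hh (h0 ▸ le_sup_right))
      refine le_antisymm hCω ?_
      have : LinearMap.ker ω = C ⊔ C' ⊓ LinearMap.ker ω := by
        rw [← sup_inf_assoc_of_le _ hCω, hsup, top_inf_eq]
      rw [this]
      exact sup_le le_rfl (hle.trans hMC)
    · left
      by_contra hne
      exact hmax C ⟨hC, hKM.trans hMC, hCω, hxC⟩ (lt_of_le_of_ne hMC (Ne.symm hne))
  have heM : e * e - e ∈ M := by rw [he, sub_self]; exact zero_mem _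
  have hB := isMaximalNormalBSubalgebra_adjoinIdempotent hω hM hMω heM heω hmax'
  unfold bRad at hx
  split_ifs at hx
  · rw [Set.mem_singleton_iff.1 hx] at hxK
    exact hxK (zero_mem _)
  · have := Set.mem_iInter₂.1 hx _ hB
    rw [barSet_adjoinIdempotent hω hM hMω heM] at this
    exact hxM this

theorem mul_mem_bRad (h : IsAlternative U) {K : Submodule F U} (hK : IsTwoSidedIdeal K)
    (hnil : ∃ n, iteratedLeftMul K n = ⊥) {e : U} (he : e * e = e) (heω : ω e = 1) {x y : U}
    (hx : x ∈ K) (hy : y ∈ K) : x * y ∈ bRad F U ω := by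
  have hKω := le_ker_of_iteratedLeftMul_eq_bot hω hnil
  have hD := h.isTwoSidedIdeal_map₂_self hK
  set D := Submodule.map₂ (LinearMap.mul F U) K K with hDdef
  have hxy : x * y ∈ D := Submodule.apply_mem_map₂ (LinearMap.mul F U) hx hy
  have hDω : D ≤ LinearMap.ker ω := by
    rw [hDdef, Submodule.map₂_le]
    exact fun a ha b _ => (isTwoSidedIdeal_ker hω a (hKω ha) b).2
  have hDN : D ≤ Submodule.map₂ (LinearMap.mul F U) K (LinearMap.ker ω) :=
    Submodule.map₂_le_map₂_right hKω
  have hnak : ∀ M : Submodule F U, IsTwoSidedIdeal M → LinearMap.ker ω ≤ M ⊔ D →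
      LinearMap.ker ω ≤ M := fun M hM hle =>
    le_of_le_map₂_sup hM hnil (hle.trans (sup_le le_sup_right (hDN.trans le_sup_left)))
  unfold bRad
  split_ifs with hs
  · have heD : e * e - e ∈ D := by rw [he, sub_self]; exact zero_mem _
    have := hs _ (isNormalBSubalgebra_adjoinIdempotent hω hD hDω heD heω)
    rw [barSet_adjoinIdempotent hω hD hDω heD] at this
    rcases this with h0 | h0
    · exact h0 ▸ hxy
    · have hle := hnak ⊥ (fun a ha u => by
        rw [(Submodule.mem_bot F).1 ha, mul_zero, zero_mul]; exact ⟨zero_mem _, zero_mem _⟩)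
        (by rw [bot_sup_eq]; exact fun a ha => (h0 ▸ ha : a ∈ (D : Set U)))
      exact (Submodule.mem_bot F).1 (hle (hDω hxy))
  · refine Set.mem_iInter₂.2 fun B hB => ?_
    obtain ⟨hB, hmax⟩ := hB
    have hM := hB.isTwoSidedIdeal
    set M := B.toSubmodule ⊓ LinearMap.ker ω with hMdef
    suffices hDM : D ≤ M from hDM hxy
    obtain ⟨c, hc, hc0⟩ := hB.1
    obtain ⟨b, hb, hbω⟩ : ∃ b ∈ B, ω b = 1 :=
      ⟨(ω c)⁻¹ • c, B.smul_mem _ hc, by rw [map_smul, smul_eq_mul, inv_mul_cancel₀ hc0]⟩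
    have hbM : b * b - b ∈ M ⊔ D := Submodule.mem_sup_left
      ⟨sub_mem (B.mul_mem hb hb) hb,
        by rw [SetLike.mem_coe, LinearMap.mem_ker, map_sub, hω, hbω]; simp⟩
    have hMDω : M ⊔ D ≤ LinearMap.ker ω := sup_le inf_le_right hDω
    have hC := isNormalBSubalgebra_adjoinIdempotent hω (hM.sup hD) hMDω hbM hbω
    have hbar := barSet_adjoinIdempotent hω (hM.sup hD) hMDω hbM
    have hBC : B ≤ adjoinIdempotent hω (M ⊔ D) (hM.sup hD) b hbM := fun z hz =>
      Submodule.mem_sup_left ⟨sub_mem hz (B.smul_mem _ hb), by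
        rw [SetLike.mem_coe, LinearMap.mem_ker, map_sub, map_smul, hbω]; simp⟩
    rcases eq_or_ne (adjoinIdempotent hω (M ⊔ D) (hM.sup hD) b hbM) ⊤ with htop | htop
    · have : LinearMap.ker ω ≤ M ⊔ D := by
        intro z hz
        rw [← SetLike.mem_coe, ← hbar, htop]
        exact ⟨trivial, hz⟩
      exact hDω.trans (hnak M hM this)
    · have hEq : B = adjoinIdempotent hω (M ⊔ D) (hM.sup hD) b hbM := by
        by_contra hne
        exact hmax ⟨_, hC, lt_of_le_of_ne hBC hne, lt_top_iff_ne_top.2 htop⟩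
      intro z hz
      have : z ∈ barSet F U ω (adjoinIdempotent hω (M ⊔ D) (hM.sup hD) b hbM) := by
        rw [hbar]; exact Submodule.mem_sup_right hz
      rw [← hEq] at this
      exact this

theorem IsWedderburnPair.exists_idempotent {K : Submodule F U} {S : NonUnitalSubalgebra F U}
    (W : IsWedderburnPair K S) (hω0 : ω ≠ 0) : ∃ e ∈ S, e * e = e ∧ ω e = 1 := by
  have hKω := le_ker_of_iteratedLeftMul_eq_bot hω W.nilpotent
  obtain ⟨N', hN', hsup, hinf⟩ := W.exists_complement _ (isTwoSidedIdeal_ker hω) hKω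
  have hKN' : K ≤ N' := hinf ▸ inf_le_right
  obtain ⟨u, hu, huω⟩ : ∃ u ∈ N', ω u ≠ 0 := by
    by_contra! hh
    have hle : N' ≤ LinearMap.ker ω := hh
    rw [sup_eq_left.2 hle] at hsup
    exact hω0 (LinearMap.ker_eq_top.1 hsup)
  obtain ⟨s, hs, k, hk, hsk⟩ := Submodule.mem_sup.1
    (W.sup_eq_top ▸ Submodule.mem_top : (ω u)⁻¹ • u ∈ S.toSubmodule ⊔ K)
  have hsN' : s ∈ N' := by
    rw [eq_sub_of_add_eq hsk]
    exact sub_mem (N'.smul_mem _ hu) (hKN' hk)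
  have hsω : ω s = 1 := by
    rw [eq_sub_of_add_eq hsk, map_sub, LinearMap.mem_ker.1 (hKω hk), map_smul, smul_eq_mul,
      inv_mul_cancel₀ huω, sub_zero]
  refine ⟨s, hs, ?_, hsω⟩
  have : s * s - s ∈ S.toSubmodule ⊓ K := by
    rw [← hinf]
    exact ⟨sub_mem (S.mul_mem hs hs) hs,
      by rw [SetLike.mem_coe, LinearMap.mem_ker, map_sub, hω, hsω]; simp,
      sub_mem (hN' s hsN' s).1 hsN'⟩
  rw [W.inf_eq_bot, Submodule.mem_bot] at this
  exact sub_eq_zero.1 this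

theorem IsWedderburnPair.isBSemisimpleSubalgebra [FiniteDimensional F U] {K : Submodule F U}
    {S : NonUnitalSubalgebra F U} (W : IsWedderburnPair K S) (hω0 : ω ≠ 0) :
    IsBSemisimpleSubalgebra F U ω S := by
  obtain ⟨e, heS, he, heω⟩ := W.exists_idempotent hω hω0
  refine ⟨⟨e, heS, by rw [heω]; exact one_ne_zero⟩, ?_⟩
  have hfd : FiniteDimensional F S := inferInstanceAs (FiniteDimensional F S.toSubmodule)
  set i := subalgebraIncl F U S with hi
  have himul : ∀ x y, i (x * y) = i x * i y := fun _ _ => rfl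
  have hiinj : Function.Injective i := Subtype.val_injective
  obtain ⟨R, hR⟩ := exists_submodule_eq_bRad (F := F) (ω := ω.comp i)
  suffices hbot : R = ⊥ by rw [← hR, hbot]; rfl
  rw [eq_bot_iff]
  intro x hx
  have hx' : x ∈ bRad F S (ω.comp i) := hR ▸ hx
  refine mem_of_mem_bRad (ω := ω.comp i) (fun x y => hω _ _) (K := ⊥) ?_ bot_le ?_
    (e := ⟨e, heS⟩) (Subtype.ext he) heω hx'
  · intro a ha u
    rw [(Submodule.mem_bot F).1 ha, mul_zero, zero_mul]; exact ⟨zero_mem _, zero_mem _⟩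
  intro J hJ _
  have hJK : IsTwoSidedIdeal (J.map i ⊔ K) := by
    intro z hz u
    obtain ⟨_, ⟨j, hj, rfl⟩, k, hk, rfl⟩ := Submodule.mem_sup.1 hz
    obtain ⟨s, hs, l, hl, rfl⟩ := Submodule.mem_sup.1
      (W.sup_eq_top ▸ Submodule.mem_top : u ∈ S.toSubmodule ⊔ K)
    have e1 : (s + l) * (i j + k) = i (⟨s, hs⟩ * j) + (l * i j + (s + l) * k) := by
      rw [himul, mul_add, add_mul, add_assoc]; rfl
    have e2 : (i j + k) * (s + l) = i (j * ⟨s, hs⟩) + (i j * l + k * (s + l)) := by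
      rw [himul, add_mul, mul_add, add_assoc]; rfl
    rw [e1, e2]
    exact ⟨Submodule.add_mem_sup (Submodule.mem_map_of_mem (hJ j hj _).1)
        (add_mem (W.ideal l hl _).2 (W.ideal k hk _).1),
      Submodule.add_mem_sup (Submodule.mem_map_of_mem (hJ j hj _).2)
        (add_mem (W.ideal l hl _).1 (W.ideal k hk _).2)⟩
  obtain ⟨I', hI', hsup, hinf⟩ := W.exists_complement _ hJK le_sup_right
  have hKI' : K ≤ I' := hinf ▸ inf_le_right
  refine ⟨I'.comap i, fun z hz u => ⟨(hI' _ hz _).1, (hI' _ hz _).2⟩, ?_, ?_⟩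
  · rw [eq_top_iff]
    intro s _
    rw [sup_assoc, sup_eq_right.2 hKI'] at hsup
    obtain ⟨_, ⟨j, hj, rfl⟩, k, hk, hjk⟩ := Submodule.mem_sup.1
      (hsup ▸ Submodule.mem_top : i s ∈ J.map i ⊔ I')
    refine Submodule.mem_sup.2 ⟨j, hj, s - j, ?_, add_sub_cancel _ _⟩
    rwa [Submodule.mem_comap, map_sub, ← hjk, add_sub_cancel_left]
  · rw [eq_bot_iff]
    rintro z ⟨hz, hz'⟩
    have hzK : i z ∈ K := hinf ▸ ⟨Submodule.mem_sup_left (Submodule.mem_map_of_mem hz), hz'⟩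
    refine hiinj ?_
    have : i z ∈ S.toSubmodule ⊓ K := ⟨z.2, hzK⟩
    rw [W.inf_eq_bot, Submodule.mem_bot] at this
    rw [this, map_zero]

end Baric

/-- **Wedderburn b-decomposition.** Let `F` be an algebraically closed field of
characteristic different from 2, 3 and 5 and let `(U, ω)` be a finite-dimensional
b-alternative algebra over `F`.  Then `U = S ⊕ V ⊕ rad(U)` (vector space direct
sum) where `S` is a b-semisimple b-subalgebra of `U` and `V` is a subspace of
`bar(U)` with `V·V ⊆ rad(U)`. -/
theorem wedderburn_b_decomposition
    (F : Type*) [Field F] [IsAlgClosed F]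
    (hchar : ringChar F ≠ 2 ∧ ringChar F ≠ 3 ∧ ringChar F ≠ 5)
    (U : Type*) [NonUnitalNonAssocRing U] [Module F U]
    [SMulCommClass F U U] [IsScalarTower F U U] [FiniteDimensional F U]
    (halt : ∀ x y : U, (x * x) * y = x * (x * y) ∧ (y * x) * x = y * (x * x))
    (ω : U →ₗ[F] F) (hωmul : ∀ x y : U, ω (x * y) = ω x * ω y) (hω0 : ω ≠ 0) :
    ∃ (S : NonUnitalSubalgebra F U) (V R : Submodule F U),
      IsBSemisimpleSubalgebra F U ω S ∧
      V ≤ LinearMap.ker ω ∧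
      (∀ v ∈ V, ∀ w ∈ V, v * w ∈ bRad F U ω) ∧
      (R : Set U) = bRad F U ω ∧
      S.toSubmodule ⊓ (V ⊔ R) = ⊥ ∧ V ⊓ R = ⊥ ∧
      S.toSubmodule ⊔ V ⊔ R = ⊤ := by
  have hprime : ∀ p : ℕ, p.Prime → ringChar F ≠ p → (p : F) ≠ 0 := fun p hp hne h0 =>
    ((Nat.dvd_prime hp).1 (ringChar.dvd h0)).elim CharP.ringChar_ne_one hne
  have h2 : (2 : F) ≠ 0 := by exact_mod_cast hprime 2 Nat.prime_two hchar.1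
  have h3 : (3 : F) ≠ 0 := by exact_mod_cast hprime 3 Nat.prime_three hchar.2.1
  obtain ⟨K, S, W⟩ := IsAlternative.exists_isWedderburnPair (F := F) halt h2 h3
  have hKω := le_ker_of_iteratedLeftMul_eq_bot hωmul W.nilpotent
  obtain ⟨e, -, he, heω⟩ := W.exists_idempotent hωmul hω0
  obtain ⟨R, hR⟩ := exists_submodule_eq_bRad (F := F) (ω := ω)
  have hRK : R ≤ K := fun x hx =>
    mem_of_mem_bRad hωmul W.ideal hKω W.exists_complement he heω (hR ▸ hx : x ∈ bRad F U ω)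
  obtain ⟨C, hC⟩ := Submodule.exists_isCompl R
  have hVR : C ⊓ K ⊔ R = K := by
    rw [sup_comm, ← sup_inf_assoc_of_le C hRK, hC.sup_eq_top, top_inf_eq]
  refine ⟨S, C ⊓ K, R, W.isBSemisimpleSubalgebra hωmul hω0, inf_le_right.trans hKω,
    fun v hv w hw => mul_mem_bRad hωmul halt W.ideal W.nilpotent he heω hv.2 hw.2, hR, ?_, ?_, ?_⟩
  · rw [hVR, W.inf_eq_bot]
  · rw [eq_bot_iff, ← hC.inf_eq_bot]
    exact fun x hx => ⟨hx.2, hx.1.1⟩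
  · rw [sup_assoc, hVR, W.sup_eq_top]
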